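/- arXiv:1012.3854 — 3 statements merged into one kernel-verified Lean document; each statement's English description precedes it below -/
import Mathlib

section
/- Let $a<b$ and $0<\varepsilon<1/2$. Let $h:[a,b]\times[0,1]\to\mathbb{C}$ be a smooth family of immersions, i.e. writing $h_t:=h(t,\cdot)$, the derivative $h_t'(s):=\partial_s h(t,s)$ is nonzero for all $t\in[a,b]$, $s\in[0,1]$. Assume that for each $t\in[a,b]$ the slope $h_t'/|h_t'|$ restricted to $[\varepsilon,1-\varepsilon]$ is a nonconstant function of $s$. Let $\bar g:[a,b]\times([0,\varepsilon]\cup[1-\varepsilon,1])\to\mathbb{C}$ be a smooth family such that for all $t$ and all $s\in[0,\varepsilon]\cup[1-\varepsilon,1]$ one has $\langle \bar g_t'(s), i\,h_t'(s)\rangle = 0$ and $\langle \bar g_t(s), i\,h_t'(s)\rangle > 0$. Then there exists a smooth family $g:[a,b]\times[0,1]\to\mathbb{C}$ which agrees with $\bar g$ on $[a,b]\times([0,\varepsilon]\cup[1-\varepsilon,1])$ and satisfies $\langle g_t'(s), i\,h_t'(s)\rangle = 0$ and $\langle g_t(s), i\,h_t'(s)\rangle > 0$ for all $t\in[a,b]$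 and all $s\in[0,1]$. -/
open Set

/-- Partial derivative in the second (interval) variable of a family `F : ℝ × ℝ → ℂ`. -/
noncomputable def ds (F : ℝ × ℝ → ℂ) (t s : ℝ) : ℂ := deriv (fun s => F (t, s)) s

/-- The standard real inner product on `ℂ ≅ ℝ²`. -/
def rinner (z w : ℂ) : ℝ := z.re * w.re + z.im * w.im

section aux

open scoped Manifold Topology

theorem aux_param_nat (n : ℕ) : ∀ (E : Type) [NormedAddCommGroup E] [NormedSpace ℝ E]
    [CompleteSpace E] (G : (ℝ × ℝ) × ℝ → E), ContDiff ℝ (⊤ : ℕ∞) G →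
    ContDiff ℝ n (fun x : ℝ × ℝ => ∫ u in (0:ℝ)..1, G (x, u)) := by
  induction n with
  | zero =>
    intro E _ _ _ G hG
    have hc : Continuous G := hG.continuous
    simp only [Nat.cast_zero, contDiff_zero]
    exact intervalIntegral.continuous_parametric_intervalIntegral_of_continuous'
      (f := fun x u => G (x, u)) hc 0 1
  | succ n ih =>
    intro E _ _ _ G hG
    have hc : Continuous G := hG.continuous
    have hfd : ContDiff ℝ (⊤ : ℕ∞) (fderiv ℝ G) := hG.fderiv_right (by simp)
    let G' : (ℝ × ℝ) × ℝ → (ℝ × ℝ →L[ℝ] E) := fun y =>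
      (fderiv ℝ G y).comp (ContinuousLinearMap.inl ℝ (ℝ × ℝ) ℝ)
    have hG' : ContDiff ℝ (⊤ : ℕ∞) G' := hfd.clm_comp contDiff_const
    have hG'c : Continuous G' := hG'.continuous
    rw [Nat.cast_succ, contDiff_succ_iff_hasFDerivAt]
    refine ⟨fun x => ∫ u in (0:ℝ)..1, G' (x, u), ih _ G' hG', ?_⟩
    intro x
    obtain ⟨C, hC⟩ := ((isCompact_closedBall x 1).prod (isCompact_Icc (a := (0:ℝ)) (b := 1))
      ).exists_bound_of_continuousOn hG'c.continuousOn
    refine intervalIntegral.hasFDerivAt_integral_of_dominated_of_fderiv_le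
      (F := fun x u => G (x, u)) (F' := fun x u => G' (x, u)) (bound := fun _ => C)
      (Metric.closedBall_mem_nhds x one_pos) ?_ ?_ ?_ ?_ ?_ ?_
    · exact Filter.Eventually.of_forall fun y => (by fun_prop : Continuous fun u => G (y, u)).aestronglyMeasurable
    · exact (by fun_prop : Continuous fun u => G (x, u)).intervalIntegrable _ _
    · exact (by fun_prop : Continuous fun u => G' (x, u)).aestronglyMeasurable
    · refine Filter.Eventually.of_forall fun u hu y hy => hC (y, u) ⟨hy, ?_⟩
      rw [uIoc_of_le zero_le_one] at hu
      exact Ioc_subset_Icc_self hu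
    · exact intervalIntegrable_const
    · refine Filter.Eventually.of_forall fun u hu y hy => ?_
      have h1 : HasFDerivAt G (fderiv ℝ G (y, u)) (y, u) :=
        (hG.differentiable (by simp) _).hasFDerivAt
      exact h1.comp y (hasFDerivAt_prodMk_left y u)

theorem aux_param (F : ℝ × ℝ → ℝ) (hF : ContDiff ℝ (⊤ : ℕ∞) F) (c : ℝ) :
    ContDiff ℝ (⊤ : ℕ∞) (fun x : ℝ × ℝ => ∫ s in c..x.2, F (x.1, s)) := by
  have h1 : ContDiff ℝ (⊤ : ℕ∞) (fun x : ℝ × ℝ => ∫ u in (0:ℝ)..1,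
      (fun y : (ℝ × ℝ) × ℝ => F (y.1.1, y.2 * (y.1.2 - c) + c)) (x, u)) := by
    rw [contDiff_infty]
    intro n
    refine aux_param_nat n ℝ (fun y : (ℝ × ℝ) × ℝ => F (y.1.1, y.2 * (y.1.2 - c) + c)) ?_
    exact hF.comp (by fun_prop)
  have h2 : (fun x : ℝ × ℝ => ∫ s in c..x.2, F (x.1, s)) = fun x : ℝ × ℝ => (x.2 - c) *
      ∫ u in (0:ℝ)..1, (fun y : (ℝ × ℝ) × ℝ => F (y.1.1, y.2 * (y.1.2 - c) + c)) (x, u) := by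
    funext x
    have := intervalIntegral.smul_integral_comp_mul_add (a := 0) (b := 1)
      (fun s => F (x.1, s)) (x.2 - c) c
    simp only [smul_eq_mul] at this
    simp only [mul_comm _ (x.2 - c)] at this ⊢
    rw [this]; simp
  rw [h2]
  exact (contDiff_snd.sub contDiff_const).mul h1

theorem aux_pos (f : ℝ × ℝ → ℝ) (hf : ContDiff ℝ (⊤ : ℕ∞) f) (S : Set (ℝ × ℝ)) (hS : IsClosed S)
    (hpos : ∀ x ∈ S, 0 < f x) :
    ∃ F : ℝ × ℝ → ℝ, ContDiff ℝ (⊤ : ℕ∞) F ∧ (∀ x, 0 < F x) ∧ ∀ x ∈ S, F x = f x := by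
  have hT : IsClosed {x | f x ≤ 0} := isClosed_le hf.continuous continuous_const
  obtain ⟨χ, h0, h1, h2⟩ := exists_contMDiffMap_zero_one_of_isClosed (n := (⊤ : ℕ∞))
    𝓘(ℝ, ℝ × ℝ) hT hS
    (by rw [Set.disjoint_left]; intro x hx hx'; exact absurd (hpos x hx') (not_lt.2 hx))
  have hχ : ContDiff ℝ (⊤ : ℕ∞) χ := χ.contMDiff.contDiff
  refine ⟨fun x => χ x * f x + (1 - χ x), by fun_prop, ?_, ?_⟩
  · intro x
    by_cases hx : f x ≤ 0
    · have : χ x = 0 := h0 hx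
      simp [this]
    · push Not at hx
      obtain ⟨h3, h4⟩ := h2 x
      rcases h3.eq_or_lt with h5 | h5
      · simp [← h5]
      · have := mul_pos h5 hx
        simp only; linarith
  · intro x hx
    have : χ x = 1 := h1 hx
    simp [this]

theorem aux_ds {E : Type*} [NormedAddCommGroup E] [NormedSpace ℝ E] (F : ℝ × ℝ → E)
    (hF : ContDiff ℝ (⊤ : ℕ∞) F) :
    ∃ F' : ℝ × ℝ → E, ContDiff ℝ (⊤ : ℕ∞) F' ∧
      ∀ t s, HasDerivAt (fun s => F (t, s)) (F' (t, s)) s := by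
  refine ⟨fun x => fderiv ℝ F x (0, 1), (hF.fderiv_right (by simp)).clm_apply contDiff_const, ?_⟩
  intro t s
  have h1 : HasFDerivAt F (fderiv ℝ F (t, s)) (t, s) :=
    (hF.differentiable (by simp) _).hasFDerivAt
  exact h1.comp_hasDerivAt s ((hasDerivAt_const s t).prodMk (hasDerivAt_id s))

theorem aux_closure (f g : ℝ → ℝ) (hf : Continuous f) (hg : Continuous g) (c d : ℝ) (hcd : c < d)
    (he : ∀ s ∈ Ioo c d, f s = g s) : ∀ s ∈ Icc c d, f s = g s := by
  have : EqOn f g (closure (Ioo c d)) := Set.EqOn.closure he hf hg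
  rw [closure_Ioo hcd.ne] at this
  exact this

theorem aux_deq (f g f' g' : ℝ → ℝ) (hf : Continuous f') (hg : Continuous g') (c d : ℝ)
    (hcd : c < d) (h1 : ∀ s, HasDerivAt f (f' s) s) (h2 : ∀ s, HasDerivAt g (g' s) s)
    (he : ∀ s ∈ Icc c d, f s = g s) : ∀ s ∈ Icc c d, f' s = g' s := by
  refine aux_closure f' g' hf hg c d hcd fun s hs => ?_
  refine (h1 s).unique ((h2 s).congr_of_eventuallyEq ?_)
  filter_upwards [Ioo_mem_nhds hs.1 hs.2] with y hy
  exact he y (Ioo_subset_Icc_self hy)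

theorem aux_core (a b ε : ℝ) (hε0 : 0 < ε) (hε1 : ε < 1 / 2)
    (X Y U V X' Y' U' V' : ℝ × ℝ → ℝ)
    (hX : ContDiff ℝ (⊤ : ℕ∞) X) (hY : ContDiff ℝ (⊤ : ℕ∞) Y)
    (hU : ContDiff ℝ (⊤ : ℕ∞) U) (hV : ContDiff ℝ (⊤ : ℕ∞) V)
    (hX' : ContDiff ℝ (⊤ : ℕ∞) X') (hY' : ContDiff ℝ (⊤ : ℕ∞) Y')
    (hU' : ContDiff ℝ (⊤ : ℕ∞) U') (hV' : ContDiff ℝ (⊤ : ℕ∞) V')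
    (dX : ∀ t s, HasDerivAt (fun s => X (t, s)) (X' (t, s)) s)
    (dY : ∀ t s, HasDerivAt (fun s => Y (t, s)) (Y' (t, s)) s)
    (dU : ∀ t s, HasDerivAt (fun s => U (t, s)) (U' (t, s)) s)
    (dV : ∀ t s, HasDerivAt (fun s => V (t, s)) (V' (t, s)) s)
    (himm : ∀ t ∈ Icc a b, ∀ s ∈ Icc (0:ℝ) 1, 0 < X (t, s) ^ 2 + Y (t, s) ^ 2)
    (hsl : ∀ t ∈ Icc a b, ∃ s ∈ Ioo ε (1 - ε), X (t, s) * Y' (t, s) - Y (t, s) * X' (t, s) ≠ 0)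
    (hst : ∀ t ∈ Icc a b, ∀ s ∈ Icc (0:ℝ) ε ∪ Icc (1 - ε) 1,
      V' (t, s) * X (t, s) - U' (t, s) * Y (t, s) = 0 ∧
      0 < V (t, s) * X (t, s) - U (t, s) * Y (t, s)) :
    ∃ u v u' v' : ℝ × ℝ → ℝ, ContDiff ℝ (⊤ : ℕ∞) u ∧ ContDiff ℝ (⊤ : ℕ∞) v ∧
      (∀ t s, HasDerivAt (fun s => u (t, s)) (u' (t, s)) s) ∧
      (∀ t s, HasDerivAt (fun s => v (t, s)) (v' (t, s)) s) ∧
      (∀ t ∈ Icc a b, ∀ s ∈ Icc (0:ℝ) ε ∪ Icc (1 - ε) 1,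
        u (t, s) = U (t, s) ∧ v (t, s) = V (t, s)) ∧
      (∀ t ∈ Icc a b, ∀ s ∈ Icc (0:ℝ) 1,
        v' (t, s) * X (t, s) - u' (t, s) * Y (t, s) = 0 ∧
        0 < v (t, s) * X (t, s) - u (t, s) * Y (t, s)) := by
  have slice : ∀ F : ℝ × ℝ → ℝ, ContDiff ℝ (⊤ : ℕ∞) F → ∀ t, Continuous fun s => F (t, s) :=
    fun F hF t => hF.continuous.comp (by fun_prop)
  have hEK : ∀ s ∈ Icc (0:ℝ) ε ∪ Icc (1 - ε) 1, s ∈ Icc (0:ℝ) 1 := by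
    rintro s (⟨h1, h2⟩ | ⟨h1, h2⟩) <;> constructor <;> linarith
  obtain ⟨N, hN, Npos, NK⟩ := aux_pos (fun x => X x ^ 2 + Y x ^ 2) (by fun_prop)
    (Icc a b ×ˢ Icc 0 1) (isClosed_Icc.prod isClosed_Icc) (fun x hx => himm x.1 hx.1 x.2 hx.2)
  obtain ⟨P, hP, Ppos, PE⟩ := aux_pos (fun x => V x * X x - U x * Y x) (by fun_prop)
    (Icc a b ×ˢ (Icc (0:ℝ) ε ∪ Icc (1 - ε) 1))
    (isClosed_Icc.prod (isClosed_Icc.union isClosed_Icc)) (fun x hx => (hst x.1 hx.1 x.2 hx.2).2)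
  obtain ⟨P', hP', dP⟩ := aux_ds P hP
  have Nne : ∀ x, N x ≠ 0 := fun x => (Npos x).ne'
  have Pne : ∀ x, P x ≠ 0 := fun x => (Ppos x).ne'
  have hpd : ∀ t s, HasDerivAt (fun s => V (t, s) * X (t, s) - U (t, s) * Y (t, s))
      (V' (t, s) * X (t, s) + V (t, s) * X' (t, s) - (U' (t, s) * Y (t, s) + U (t, s) * Y' (t, s)))
      s := fun t s => ((dV t s).mul (dX t s)).sub ((dU t s).mul (dY t s))
  -- derivative of P on the strips
  have hP'E : ∀ t ∈ Icc a b, ∀ s ∈ Icc (0:ℝ) ε ∪ Icc (1 - ε) 1,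
      P' (t, s) = V (t, s) * X' (t, s) - U (t, s) * Y' (t, s) := by
    intro t ht s hs
    have key : P' (t, s) = V' (t, s) * X (t, s) + V (t, s) * X' (t, s) -
        (U' (t, s) * Y (t, s) + U (t, s) * Y' (t, s)) := by
      rcases hs with hs | hs
      · exact aux_deq _ _ (fun s => P' (t, s)) (fun s => V' (t, s) * X (t, s) + V (t, s) * X' (t, s) -
          (U' (t, s) * Y (t, s) + U (t, s) * Y' (t, s))) (slice _ hP' t)
          (slice (fun x => V' x * X x + V x * X' x - (U' x * Y x + U x * Y' x)) (by fun_prop) t)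
          0 ε hε0 (dP t) (hpd t) (fun s hs => PE (t, s) ⟨ht, Or.inl hs⟩) s hs
      · exact aux_deq _ _ (fun s => P' (t, s)) (fun s => V' (t, s) * X (t, s) + V (t, s) * X' (t, s) -
          (U' (t, s) * Y (t, s) + U (t, s) * Y' (t, s))) (slice _ hP' t)
          (slice (fun x => V' x * X x + V x * X' x - (U' x * Y x + U x * Y' x)) (by fun_prop) t)
          (1 - ε) 1 (by linarith) (dP t) (hpd t) (fun s hs => PE (t, s) ⟨ht, Or.inr hs⟩) s hs
    have := (hst t ht s hs).1
    linarith
  obtain ⟨α, hαd⟩ : ∃ α : ℝ × ℝ → ℝ, α = fun x => (X x * X' x + Y x * Y' x) / N x := ⟨_, rfl⟩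
  obtain ⟨β, hβd⟩ : ∃ β : ℝ × ℝ → ℝ, β = fun x => (X x * Y' x - Y x * X' x) / N x := ⟨_, rfl⟩
  obtain ⟨w0, hw0d⟩ : ∃ w0 : ℝ × ℝ → ℝ, w0 = fun x => -(U x * X x + V x * Y x) / P x := ⟨_, rfl⟩
  have hα : ContDiff ℝ (⊤ : ℕ∞) α := by
    rw [hαd]; exact ContDiff.div (by fun_prop) hN Nne
  have hβ : ContDiff ℝ (⊤ : ℕ∞) β := by
    rw [hβd]; exact ContDiff.div (by fun_prop) hN Nne
  have hw0 : ContDiff ℝ (⊤ : ℕ∞) w0 := by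
    rw [hw0d]; exact ContDiff.div (by fun_prop) hP Pne
  obtain ⟨F0, hF0d⟩ : ∃ F0 : ℝ × ℝ → ℝ, F0 = fun x => α x + β x * w0 x - P' x / P x := ⟨_, rfl⟩
  have hF0 : ContDiff ℝ (⊤ : ℕ∞) F0 := by
    rw [hF0d]; exact ContDiff.sub (by fun_prop) (hP'.div hP Pne)
  have F0E : ∀ t ∈ Icc a b, ∀ s ∈ Icc (0:ℝ) ε ∪ Icc (1 - ε) 1, F0 (t, s) = 0 := by
    intro t ht s hs
    have e1 : N (t, s) = X (t, s) ^ 2 + Y (t, s) ^ 2 := NK (t, s) ⟨ht, hEK s hs⟩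
    have e2 : P (t, s) = V (t, s) * X (t, s) - U (t, s) * Y (t, s) := PE (t, s) ⟨ht, hs⟩
    have n1 := Nne (t, s)
    have n2 := Pne (t, s)
    simp only [hF0d, hαd, hβd, hw0d, hP'E t ht s hs]
    field_simp
    rw [e1, e2]
    ring
  obtain ⟨χ, hχd⟩ : ∃ χ : ℝ × ℝ → ℝ, χ = fun x => expNegInvGlue (x.2 - ε) * expNegInvGlue (1 - ε - x.2) :=
    ⟨_, rfl⟩
  have hχ : ContDiff ℝ (⊤ : ℕ∞) χ := by
    rw [hχd]
    exact (expNegInvGlue.contDiff.comp (by fun_prop)).mul (expNegInvGlue.contDiff.comp (by fun_prop))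
  have χnn : ∀ x, 0 ≤ χ x := fun x => by
    rw [hχd]; exact mul_nonneg (expNegInvGlue.nonneg _) (expNegInvGlue.nonneg _)
  have χpos : ∀ t, ∀ s ∈ Ioo ε (1 - ε), 0 < χ (t, s) := fun t s hs => by
    rw [hχd]; exact mul_pos (expNegInvGlue.pos_of_pos (by simpa using hs.1))
      (expNegInvGlue.pos_of_pos (by simpa using hs.2))
  have χE : ∀ t, ∀ s ∈ Icc (0:ℝ) ε ∪ Icc (1 - ε) 1, χ (t, s) = 0 := by
    rintro t s (hs | hs)
    · simp only [hχd]; rw [expNegInvGlue.zero_of_nonpos (by linarith [hs.2]), zero_mul]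
    · simp only [hχd]; rw [expNegInvGlue.zero_of_nonpos (x := 1 - ε - s) (by linarith [hs.1]), mul_zero]
  have hB : ContDiff ℝ (⊤ : ℕ∞) (fun x => χ x * β x ^ 2) := by fun_prop
  have hend : ContDiff ℝ (⊤ : ℕ∞) (fun x : ℝ × ℝ => ((x.1, 1 - ε) : ℝ × ℝ)) := by fun_prop
  have hend0 : ContDiff ℝ (⊤ : ℕ∞) (fun x : ℝ × ℝ => ((x.1, 0) : ℝ × ℝ)) := by fun_prop
  have hD0 : ContDiff ℝ (⊤ : ℕ∞) (fun x : ℝ × ℝ => ∫ s in ε..(1 - ε), χ (x.1, s) * β (x.1, s) ^ 2) :=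
    (aux_param _ hB ε).comp hend
  have hI0 : ContDiff ℝ (⊤ : ℕ∞) (fun x : ℝ × ℝ => ∫ s in ε..(1 - ε), F0 (x.1, s)) :=
    (aux_param _ hF0 ε).comp hend
  obtain ⟨D, hD, Dpos, DE⟩ := aux_pos _ hD0 (Icc a b ×ˢ univ) (isClosed_Icc.prod isClosed_univ) (by
    rintro ⟨t, s⟩ ⟨ht, -⟩
    obtain ⟨s0, hs0, hne⟩ := hsl t ht
    refine intervalIntegral.integral_pos (by linarith) (slice _ hB t).continuousOn
      (fun s _ => mul_nonneg (χnn _) (sq_nonneg _)) ⟨s0, Ioo_subset_Icc_self hs0, ?_⟩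
    refine mul_pos (χpos t s0 hs0) (sq_pos_of_ne_zero ?_)
    rw [hβd]
    exact div_ne_zero hne (Nne _))
  obtain ⟨lam, hlamd⟩ : ∃ lam : ℝ × ℝ → ℝ,
      lam = fun x => -(∫ s in ε..(1 - ε), F0 (x.1, s)) / D (x.1, 0) := ⟨_, rfl⟩
  have hlam : ContDiff ℝ (⊤ : ℕ∞) lam := by
    rw [hlamd]; exact hI0.neg.div (hD.comp hend0) (fun x => (Dpos _).ne')
  obtain ⟨Φ, hΦd⟩ : ∃ Φ : ℝ × ℝ → ℝ, Φ = fun x => F0 x + lam x * (χ x * β x ^ 2) := ⟨_, rfl⟩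
  have hΦ : ContDiff ℝ (⊤ : ℕ∞) Φ := by rw [hΦd]; fun_prop
  have ΦE : ∀ t ∈ Icc a b, ∀ s ∈ Icc (0:ℝ) ε ∪ Icc (1 - ε) 1, Φ (t, s) = 0 := by
    intro t ht s hs
    simp [hΦd, F0E t ht s hs, χE t s hs]
  obtain ⟨J, hJd⟩ : ∃ J : ℝ × ℝ → ℝ, J = fun x => ∫ s in ε..x.2, Φ (x.1, s) := ⟨_, rfl⟩
  have hJ : ContDiff ℝ (⊤ : ℕ∞) J := by rw [hJd]; exact aux_param Φ hΦ ε
  have dJ : ∀ t s, HasDerivAt (fun s => J (t, s)) (Φ (t, s)) s := by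
    intro t s
    rw [hJd]
    exact intervalIntegral.integral_hasDerivAt_right ((slice _ hΦ t).intervalIntegrable _ _)
      (slice _ hΦ t).stronglyMeasurable.stronglyMeasurableAtFilter (slice _ hΦ t).continuousAt
  have JE : ∀ t ∈ Icc a b, ∀ s ∈ Icc (0:ℝ) ε ∪ Icc (1 - ε) 1, J (t, s) = 0 := by
    intro t ht s hs
    simp only [hJd]
    rcases hs with hs | hs
    · rw [intervalIntegral.integral_congr (g := fun _ => (0:ℝ)), intervalIntegral.integral_zero]
      intro σ hσ
      rw [uIcc_of_ge hs.2] at hσ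
      exact ΦE t ht σ (Or.inl ⟨hs.1.trans hσ.1, hσ.2⟩)
    · rw [← intervalIntegral.integral_add_adjacent_intervals (b := 1 - ε)
        ((slice _ hΦ t).intervalIntegrable _ _) ((slice _ hΦ t).intervalIntegrable _ _)]
      rw [intervalIntegral.integral_congr (a := 1 - ε) (g := fun _ => (0:ℝ)),
        intervalIntegral.integral_zero]
      swap
      · intro σ hσ
        rw [uIcc_of_le hs.1] at hσ
        exact ΦE t ht σ (Or.inr ⟨hσ.1, hσ.2.trans hs.2⟩)
      have e : ∀ σ, Φ (t, σ) = F0 (t, σ) + lam (t, 0) * (χ (t, σ) * β (t, σ) ^ 2) := by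
        intro σ; simp only [hΦd, hlamd]
      simp only [e]
      rw [intervalIntegral.integral_add ((slice _ hF0 t).intervalIntegrable _ _)
        (((slice _ hB t).intervalIntegrable _ _).const_mul _),
        intervalIntegral.integral_const_mul]
      have e3 : D (t, 0) = ∫ s in ε..(1 - ε), χ (t, s) * β (t, s) ^ 2 := DE (t, 0) ⟨ht, mem_univ _⟩
      rw [← e3]
      simp only [hlamd]
      have := (Dpos (t, 0)).ne'
      field_simp
      ring
  obtain ⟨p, hpdef⟩ : ∃ p : ℝ × ℝ → ℝ, p = fun x => P x * Real.exp (J x) := ⟨_, rfl⟩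
  have hp : ContDiff ℝ (⊤ : ℕ∞) p := by rw [hpdef]; exact hP.mul hJ.exp
  have ppos : ∀ x, 0 < p x := fun x => by rw [hpdef]; exact mul_pos (Ppos x) (Real.exp_pos _)
  obtain ⟨w, hwd⟩ : ∃ w : ℝ × ℝ → ℝ, w = fun x => w0 x + lam x * χ x * β x := ⟨_, rfl⟩
  have hw : ContDiff ℝ (⊤ : ℕ∞) w := by rw [hwd]; fun_prop
  have dp : ∀ t s, HasDerivAt (fun s => p (t, s)) (p (t, s) * (α (t, s) + β (t, s) * w (t, s))) s := by
    intro t s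
    have := (dP t s).mul (dJ t s).exp
    have n2 := Pne (t, s)
    rw [hpdef]
    refine HasDerivAt.congr_deriv this ?_
    simp only [hΦd, hF0d, hwd]
    field_simp
    ring
  obtain ⟨u, hud⟩ : ∃ u : ℝ × ℝ → ℝ, u = fun x => p x * (-Y x - w x * X x) / N x := ⟨_, rfl⟩
  obtain ⟨v, hvd⟩ : ∃ v : ℝ × ℝ → ℝ, v = fun x => p x * (X x - w x * Y x) / N x := ⟨_, rfl⟩
  have hu : ContDiff ℝ (⊤ : ℕ∞) u := by
    rw [hud]; exact ContDiff.div (by fun_prop) hN Nne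
  have hv : ContDiff ℝ (⊤ : ℕ∞) v := by
    rw [hvd]; exact ContDiff.div (by fun_prop) hN Nne
  obtain ⟨u', hu', du⟩ := aux_ds u hu
  obtain ⟨v', hv', dv⟩ := aux_ds v hv
  have hpe : ∀ t ∈ Icc a b, ∀ s ∈ Icc (0:ℝ) 1,
      v (t, s) * X (t, s) - u (t, s) * Y (t, s) = p (t, s) := by
    intro t ht s hs
    have e1 : N (t, s) = X (t, s) ^ 2 + Y (t, s) ^ 2 := NK (t, s) ⟨ht, hs⟩
    have n1 := Nne (t, s)
    simp only [hud, hvd]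
    field_simp
    rw [e1]
    ring
  refine ⟨u, v, u', v', hu, hv, du, dv, ?_, ?_⟩
  · intro t ht s hs
    have e1 : N (t, s) = X (t, s) ^ 2 + Y (t, s) ^ 2 := NK (t, s) ⟨ht, hEK s hs⟩
    have e2 : P (t, s) = V (t, s) * X (t, s) - U (t, s) * Y (t, s) := PE (t, s) ⟨ht, hs⟩
    have e3 : p (t, s) = P (t, s) := by simp [hpdef, JE t ht s hs]
    have e4 : w (t, s) = -(U (t, s) * X (t, s) + V (t, s) * Y (t, s)) / P (t, s) := by
      simp [hwd, χE t s hs, hw0d]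
    have n1 := Nne (t, s)
    have n2 := Pne (t, s)
    simp only [hud, hvd, e3, e4]
    constructor
    · field_simp
      rw [e1, e2]
      ring
    · field_simp
      rw [e1, e2]
      ring
  · intro t ht s hs
    refine ⟨?_, by rw [hpe t ht s hs]; exact ppos _⟩
    have key : v' (t, s) * X (t, s) + v (t, s) * X' (t, s) -
        (u' (t, s) * Y (t, s) + u (t, s) * Y' (t, s)) =
        p (t, s) * (α (t, s) + β (t, s) * w (t, s)) :=
      aux_deq _ _ (fun s => v' (t, s) * X (t, s) + v (t, s) * X' (t, s) -
        (u' (t, s) * Y (t, s) + u (t, s) * Y' (t, s)))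
        (fun s => p (t, s) * (α (t, s) + β (t, s) * w (t, s)))
        (slice (fun x => v' x * X x + v x * X' x - (u' x * Y x + u x * Y' x)) (by fun_prop) t)
        (slice (fun x => p x * (α x + β x * w x)) (by fun_prop) t) 0 1 one_pos
        (fun s => ((dv t s).mul (dX t s)).sub ((du t s).mul (dY t s))) (dp t) (hpe t ht) s hs
    have e1 : N (t, s) = X (t, s) ^ 2 + Y (t, s) ^ 2 := NK (t, s) ⟨ht, hs⟩
    have n1 := Nne (t, s)
    have e5 : v (t, s) * X' (t, s) - u (t, s) * Y' (t, s) =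
        p (t, s) * (α (t, s) + β (t, s) * w (t, s)) := by
      simp only [hud, hvd, hαd, hβd]
      field_simp
      ring
    linarith

theorem aux_slope (ε : ℝ) (hε1 : ε < 1 / 2) (H H' : ℝ → ℂ) (hH' : Continuous H')
    (dH : ∀ s, HasDerivAt H (H' s) s) (hne : ∀ s ∈ Icc ε (1 - ε), H s ≠ 0)
    (h0 : ∀ s ∈ Ioo ε (1 - ε), (H s).re * (H' s).im - (H s).im * (H' s).re = 0) :
    ∀ s ∈ Icc ε (1 - ε), H s / (‖H s‖ : ℂ) = H ε / (‖H ε‖ : ℂ) := by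
  have hH : Continuous H := continuous_iff_continuousAt.2 fun s => (dH s).continuousAt
  have h0' := aux_closure (fun s => (H s).re * (H' s).im - (H s).im * (H' s).re) (fun _ => 0)
    (by fun_prop) (by fun_prop) _ _ (by linarith) h0
  have hnn : ∀ s ∈ Icc ε (1 - ε), ‖H s‖ ≠ 0 := fun s hs => norm_ne_zero_iff.2 (hne s hs)
  have dn : ∀ s ∈ Icc ε (1 - ε), HasDerivAt (fun s => ‖H s‖)
      (((H s).re * (H' s).re + (H s).im * (H' s).im) / ‖H s‖) s := by
    intro s hs
    have hr : HasDerivAt (fun s => (H s).re) (H' s).re s := by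
      exact (Complex.reCLM.hasFDerivAt.comp_hasDerivAt s (dH s))
    have hi : HasDerivAt (fun s => (H s).im) (H' s).im s := by
      exact (Complex.imCLM.hasFDerivAt.comp_hasDerivAt s (dH s))
    have hnorm : ∀ s, ‖H s‖ = Real.sqrt ((H s).re * (H s).re + (H s).im * (H s).im) := fun s => by
      rw [Complex.norm_def, Complex.normSq_apply]
    have hx : (H s).re * (H s).re + (H s).im * (H s).im ≠ 0 := by
      intro h; exact hnn s hs (by rw [hnorm, h, Real.sqrt_zero])
    have h2 : HasDerivAt (fun s => (H s).re * (H s).re + (H s).im * (H s).im)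
        ((H' s).re * (H s).re + (H s).re * (H' s).re +
          ((H' s).im * (H s).im + (H s).im * (H' s).im)) s := (hr.mul hr).add (hi.mul hi)
    have := h2.sqrt hx
    have hn := hnn s hs
    simp only [hnorm] at hn ⊢
    refine HasDerivAt.congr_deriv this ?_
    field_simp
    ring
  apply constant_of_has_deriv_right_zero
  · intro s hs
    exact ((hH.continuousAt).div (by fun_prop) (by exact_mod_cast hnn s hs)).continuousWithinAt
  · intro s hs
    have hs' := Ico_subset_Icc_self hs
    have hn := hnn s hs'
    have hn' : (‖H s‖ : ℂ) ≠ 0 := by exact_mod_cast hn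
    have := (dH s).div (dn s hs').ofReal_comp hn'
    refine HasDerivAt.hasDerivWithinAt ?_
    refine HasDerivAt.congr_deriv this ?_
    rw [div_eq_zero_iff]
    left
    have e : (‖H s‖:ℝ) ^ 2 = (H s).re * (H s).re + (H s).im * (H s).im := by
      rw [← Complex.normSq_eq_norm_sq, Complex.normSq_apply]
    have h00 := h0' s hs'
    push_cast
    rw [sub_eq_zero, ← mul_div_assoc, eq_div_iff hn', mul_assoc, ← sq]
    have e' : (‖H s‖ : ℂ) ^ 2 = ((‖H s‖ ^ 2 : ℝ) : ℂ) := by push_cast; rfl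
    rw [e', e]
    apply Complex.ext
    · simp
      linear_combination (-(H s).im) * h00
    · simp
      linear_combination ((H s).re) * h00

end aux

/-- **Extension of families of stabilizing functions.** Let `a < b`, `0 < ε < 1/2`,
and let `h : [a,b] × [0,1] → ℂ` be a smooth family of immersions such that for each
`t` the slope `h_t'/|h_t'|` restricted to `[ε,1-ε]` is nonconstant. Let
`ḡ : [a,b] × ([0,ε] ∪ [1-ε,1]) → ℂ` be a smooth family with `⟨ḡ_t',ih_t'⟩ = 0` and
`⟨ḡ_t,ih_t'⟩ > 0` there. Then there is a smooth family `g : [a,b] × [0,1] → ℂ`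
agreeing with `ḡ` on `[a,b] × ([0,ε] ∪ [1-ε,1])` and satisfying `⟨g_t',ih_t'⟩ = 0`
and `⟨g_t,ih_t'⟩ > 0` on all of `[a,b] × [0,1]`. -/
theorem stmt_0 (a b ε : ℝ) (hab : a < b) (hε0 : 0 < ε) (hε1 : ε < 1 / 2)
    (h : ℝ × ℝ → ℂ) (hh : ContDiff ℝ (⊤ : ℕ∞) h)
    (himm : ∀ t ∈ Icc a b, ∀ s ∈ Icc (0:ℝ) 1, ds h t s ≠ 0)
    (hslope : ∀ t ∈ Icc a b, ∃ s₁ ∈ Icc ε (1 - ε), ∃ s₂ ∈ Icc ε (1 - ε),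
      ds h t s₁ / (‖ds h t s₁‖ : ℂ) ≠ ds h t s₂ / (‖ds h t s₂‖ : ℂ))
    (gbar : ℝ × ℝ → ℂ) (hgbar : ContDiff ℝ (⊤ : ℕ∞) gbar)
    (hstab : ∀ t ∈ Icc a b, ∀ s ∈ Icc (0:ℝ) ε ∪ Icc (1 - ε) 1,
      rinner (ds gbar t s) (Complex.I * ds h t s) = 0 ∧
      0 < rinner (gbar (t, s)) (Complex.I * ds h t s)) :
    ∃ g : ℝ × ℝ → ℂ, ContDiff ℝ (⊤ : ℕ∞) g ∧
      (∀ t ∈ Icc a b, ∀ s ∈ Icc (0:ℝ) ε ∪ Icc (1 - ε) 1, g (t, s) = gbar (t, s)) ∧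
      (∀ t ∈ Icc a b, ∀ s ∈ Icc (0:ℝ) 1,
        rinner (ds g t s) (Complex.I * ds h t s) = 0 ∧
        0 < rinner (g (t, s)) (Complex.I * ds h t s)) := by
  obtain ⟨H, hH, dh⟩ := aux_ds h hh
  obtain ⟨H', hH', dH⟩ := aux_ds H hH
  obtain ⟨G', hG', dG⟩ := aux_ds gbar hgbar
  have eh : ∀ t s, ds h t s = H (t, s) := fun t s => (dh t s).deriv
  have eg : ∀ t s, ds gbar t s = G' (t, s) := fun t s => (dG t s).deriv
  simp only [eh, eg] at himm hslope hstab ⊢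
  have hre : ∀ F : ℝ × ℝ → ℂ, ContDiff ℝ (⊤ : ℕ∞) F → ContDiff ℝ (⊤ : ℕ∞) fun x => (F x).re :=
    fun F hF => Complex.reCLM.contDiff.comp hF
  have him : ∀ F : ℝ × ℝ → ℂ, ContDiff ℝ (⊤ : ℕ∞) F → ContDiff ℝ (⊤ : ℕ∞) fun x => (F x).im :=
    fun F hF => Complex.imCLM.contDiff.comp hF
  have dre : ∀ F F' : ℝ × ℝ → ℂ, (∀ t s, HasDerivAt (fun s => F (t, s)) (F' (t, s)) s) →
      ∀ t s, HasDerivAt (fun s => (F (t, s)).re) (F' (t, s)).re s :=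
    fun F F' hF t s => Complex.reCLM.hasFDerivAt.comp_hasDerivAt s (hF t s)
  have dim : ∀ F F' : ℝ × ℝ → ℂ, (∀ t s, HasDerivAt (fun s => F (t, s)) (F' (t, s)) s) →
      ∀ t s, HasDerivAt (fun s => (F (t, s)).im) (F' (t, s)).im s :=
    fun F F' hF t s => Complex.imCLM.hasFDerivAt.comp_hasDerivAt s (hF t s)
  have er : ∀ z w : ℂ, rinner z (Complex.I * w) = z.im * w.re - z.re * w.im := by
    intro z w; simp [rinner]; ring
  simp only [er] at hstab ⊢
  obtain ⟨u, v, u', v', hu, hv, du, dv, h1, h2⟩ := aux_core a b ε hε0 hε1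
    (fun x => (H x).re) (fun x => (H x).im) (fun x => (gbar x).re) (fun x => (gbar x).im)
    (fun x => (H' x).re) (fun x => (H' x).im) (fun x => (G' x).re) (fun x => (G' x).im)
    (hre _ hH) (him _ hH) (hre _ hgbar) (him _ hgbar)
    (hre _ hH') (him _ hH') (hre _ hG') (him _ hG')
    (dre _ _ dH) (dim _ _ dH) (dre _ _ dG) (dim _ _ dG)
    (by
      intro t ht s hs
      have := Complex.normSq_pos.2 (himm t ht s hs)
      rw [Complex.normSq_apply] at this
      nlinarith)
    (by
      intro t ht
      by_contra! hcon
      obtain ⟨s₁, hs₁, s₂, hs₂, hne⟩ := hslope t ht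
      have key := aux_slope ε hε1 (fun s => H (t, s)) (fun s => H' (t, s))
        (hH'.continuous.comp (by fun_prop)) (dH t)
        (fun s hs => himm t ht s ⟨by linarith [hs.1], by linarith [hs.2]⟩) hcon
      exact hne ((key s₁ hs₁).trans (key s₂ hs₂).symm))
    hstab
  have hg : ContDiff ℝ (⊤ : ℕ∞) (fun x => (u x : ℂ) + (v x : ℂ) * Complex.I) :=
    (Complex.ofRealCLM.contDiff.comp hu).add ((Complex.ofRealCLM.contDiff.comp hv).mul contDiff_const)
  refine ⟨fun x => (u x : ℂ) + (v x : ℂ) * Complex.I, hg, ?_, ?_⟩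
  · intro t ht s hs
    obtain ⟨e1, e2⟩ := h1 t ht s hs
    apply Complex.ext <;> simp [e1, e2]
  · intro t ht s hs
    have ed : ds (fun x => (u x : ℂ) + (v x : ℂ) * Complex.I) t s =
        (u' (t, s) : ℂ) + (v' (t, s) : ℂ) * Complex.I :=
      ((du t s).ofReal_comp.add ((dv t s).ofReal_comp.mul_const _)).deriv
    rw [ed]
    simpa using h2 t ht s hs
end

section
/- Let $V=S^1\times D^2_\delta$ be the solid torus with coordinate $\theta\in\mathbb{R}/2\pi\mathbb{Z}$ on $S^1$ and polar coordinates $(r,\phi)$ on the closed disk $D^2_\delta$ of radius $\delta>0$. Let $\alpha$ be a positive contact form on $V$ defining the standard contact structure $\xi_{st}=\ker(d\theta+r^2 d\phi)$, i.e. $\alpha=f\cdot(d\theta+r^2d\phi)$ for a smooth positive function $f$ on $V$. Let $\pi:V\to S^1=\mathbb{R}/2\pi\mathbb{Z}$ be a smooth submersion with $d\pi\wedge d\alpha>0$ on $V$, whose restriction to the core circle $K=S^1\times\{0\}$ is a covering map $K\to S^1$ of degree $n\in\mathbb{N}$. Then there exist: (a) a smooth submersion $\pi':V\to S^1$ which agrees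 with $\pi$ on a neighbourhood of $\partial V$ and satisfies $\pi'(\theta,r,\phi)=n\theta$ on a neighbourhood of $K$; and (b) a positive contact form $\alpha'$ on $V$ defining $\xi_{st}$ with $d\pi'\wedge d\alpha'>0$, which coincides with $\alpha$ on a neighbourhood of $\partial V$ and with $d\theta+r^2d\phi$ on a neighbourhood of $K$. -/
open Set Real

/-- A point of the solid torus `S¹ × D²`, in coordinates `(θ, x, y)`: the first
coordinate is the angle along `S¹` (functions on the solid torus are required to be
periodic in it), and `(x,y)` are Cartesian coordinates on the disk, with associated
polar coordinates `(r,φ)`. -/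
abbrev Pt : Type := ℝ × ℝ × ℝ

/-- Partial derivative in the angular (first) coordinate. -/
noncomputable def pdA (f : Pt → ℝ) (q : Pt) : ℝ := fderiv ℝ f q (1, 0, 0)
/-- Partial derivative in `x`. -/
noncomputable def pdX (f : Pt → ℝ) (q : Pt) : ℝ := fderiv ℝ f q (0, 1, 0)
/-- Partial derivative in `y`. -/
noncomputable def pdY (f : Pt → ℝ) (q : Pt) : ℝ := fderiv ℝ f q (0, 0, 1)

/-- The coefficient, with respect to the orientation form `dθ∧dx∧dy`, of the 3-form
`c ∧ db`, where the 1-forms `c` and `b` are described by their coefficient functions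
with respect to `(dθ, dx, dy)`. -/
noncomputable def wedgeD (c b : Pt → Pt) (q : Pt) : ℝ :=
  (c q).1 * (pdX (fun p => (b p).2.2) q - pdY (fun p => (b p).2.1) q)
  - (c q).2.1 * (pdA (fun p => (b p).2.2) q - pdY (fun p => (b p).1) q)
  + (c q).2.2 * (pdA (fun p => (b p).2.1) q - pdX (fun p => (b p).1) q)

/-- The differential of a function, as a 1-form (coefficients w.r.t. `(dθ,dx,dy)`). -/
noncomputable def gradOf (f : Pt → ℝ) (q : Pt) : Pt := (pdA f q, pdX f q, pdY f q)

/-- The radial coordinate on the disk factor. -/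
noncomputable def rad (q : Pt) : ℝ := Real.sqrt (q.2.1 ^ 2 + q.2.2 ^ 2)

/-- The solid torus of disk-radius `δ` (the angular coordinate ranges over all of `ℝ`;
periodicity is imposed on the functions involved). -/
def Vset (δ : ℝ) : Set Pt := {q | q.2.1 ^ 2 + q.2.2 ^ 2 ≤ δ ^ 2}

/-- Periodicity in the angular coordinate, for functions. -/
def IsPeriodic (P : ℝ) (f : Pt → ℝ) : Prop := ∀ q : Pt, f (q.1 + P, q.2) = f q

/-- Periodicity in the angular coordinate, for (coefficient functions of) 1-forms. -/
def IsPeriodicForm (P : ℝ) (α : Pt → Pt) : Prop := ∀ q : Pt, α (q.1 + P, q.2) = α q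

/-- The standard contact form `α_st = dθ + r²dφ = dθ + x dy - y dx` on the solid
torus, given by its coefficients `(1, -y, x)` w.r.t. `(dθ, dx, dy)`. -/
def alphaSt : Pt → Pt := fun q => (1, -q.2.2, q.2.1)



/-- Squared radius. -/
noncomputable def usq (q : Pt) : ℝ := q.2.1 ^ 2 + q.2.2 ^ 2

lemma usq_nonneg (q : Pt) : 0 ≤ usq q := by unfold usq; positivity

lemma norm_sq_le_usq (q : Pt) : ‖q.2‖ ^ 2 ≤ usq q := by
  unfold usq
  rw [Prod.norm_def]
  rcases max_cases ‖q.2.1‖ ‖q.2.2‖ with h | h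
  · rw [h.1, Real.norm_eq_abs, sq_abs]; nlinarith [sq_nonneg q.2.2]
  · rw [h.1, Real.norm_eq_abs, sq_abs]; nlinarith [sq_nonneg q.2.1]

lemma norm_le_one_of_usq (q : Pt) (h : usq q ≤ 1) : ‖q.2‖ ≤ 1 := by
  have := norm_sq_le_usq q
  nlinarith [norm_nonneg q.2]

lemma exists_ico (G : Pt → ℝ) (hper : IsPeriodic (2 * π) G) (q : Pt) :
    ∃ t ∈ Icc (0:ℝ) (2 * π), G q = G (t, q.2) := by
  have hP : Function.Periodic (fun t : ℝ => G (t, q.2)) (2 * π) := fun t => hper (t, q.2)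
  obtain ⟨y, hy, h⟩ := hP.exists_mem_Ico₀ (by positivity) q.1
  exact ⟨y, Ico_subset_Icc_self hy, h⟩

lemma exists_lower (G : Pt → ℝ) (hc : Continuous G) (hper : IsPeriodic (2 * π) G)
    (hpos : ∀ t : ℝ, 0 < G (t, 0, 0)) :
    ∃ b > 0, ∃ m > 0, ∀ q, usq q ≤ b → m ≤ G q := by
  have hK : IsCompact (Icc (0:ℝ) (2 * π)) := isCompact_Icc
  obtain ⟨t0, -, ht0⟩ := hK.exists_isMinOn ⟨0, by constructor <;> positivity⟩
    (f := fun t : ℝ => G (t, 0, 0)) (by fun_prop)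
  set m := G (t0, 0, 0) / 2 with hm
  have hm0 : 0 < m := by have := hpos t0; positivity
  have hopen : IsOpen {q : Pt | m < G q} := isOpen_lt continuous_const hc
  have hsub : (Icc (0:ℝ) (2 * π)) ×ˢ ({(0, 0)} : Set (ℝ × ℝ)) ⊆ {q : Pt | m < G q} := by
    rintro ⟨t, z⟩ ⟨ht, hz⟩
    simp only [mem_singleton_iff] at hz
    subst hz
    have h1 : G (t0, 0, 0) ≤ G (t, 0, 0) := ht0 ht
    have h2 := hpos t0
    show m < G (t, 0, 0)
    linarith
  obtain ⟨U, W, -, hWo, hU, hW, hUW⟩ :=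
    generalized_tube_lemma hK isCompact_singleton hopen hsub
  have hW0 : (0 : ℝ × ℝ) ∈ W := hW rfl
  obtain ⟨ε, hε, hball⟩ := Metric.isOpen_iff.1 hWo 0 hW0
  refine ⟨(ε / 2) ^ 2, by positivity, m, hm0, fun q hq => ?_⟩
  obtain ⟨t, ht, hGt⟩ := exists_ico G hper q
  rw [hGt]
  have h1 := norm_sq_le_usq q
  have h2 : ‖q.2‖ ≤ ε / 2 := by
    apply le_of_sq_le_sq (h1.trans hq) (by positivity)
  have h3 : q.2 ∈ W := hball (by rw [mem_ball_zero_iff]; linarith)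
  exact le_of_lt (hUW (show (t, q.2) ∈ U ×ˢ W from ⟨hU ht, h3⟩))

lemma exists_bound (G : Pt → ℝ) (hc : Continuous G) (hper : IsPeriodic (2 * π) G) :
    ∃ C > 0, ∀ q : Pt, ‖q.2‖ ≤ 1 → |G q| ≤ C := by
  have hK : IsCompact ((Icc (0:ℝ) (2 * π)) ×ˢ (Metric.closedBall (0 : ℝ × ℝ) 1)) :=
    isCompact_Icc.prod (isCompact_closedBall _ _)
  obtain ⟨C, hC⟩ := hK.exists_bound_of_continuousOn hc.continuousOn
  refine ⟨max C 1, by positivity, fun q hq => ?_⟩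
  obtain ⟨t, ht, hGt⟩ := exists_ico G hper q
  rw [hGt]
  exact (hC (t, q.2) ⟨ht, by simpa using hq⟩).trans (le_max_left _ _)

lemma fderiv_shift (h : Pt → ℝ) (P c : ℝ) (hh : ∀ q : Pt, h (q.1 + P, q.2) = h q + c) (q : Pt) :
    fderiv ℝ h (q.1 + P, q.2) = fderiv ℝ h q := by
  have e1 : (fun q : Pt => h (q + ((P, 0) : Pt))) = fun q => h q + c := by
    funext q
    rw [← hh q]
    congr 1
    ext <;> simp
  have e2 : ((q.1 + P, q.2) : Pt) = q + ((P, 0) : Pt) := by ext <;> simp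
  rw [e2, ← fderiv_comp_add_right, e1, fderiv_add_const]

lemma cont_fderiv (h : Pt → ℝ) (hs : ContDiff ℝ (⊤ : ℕ∞) h) (v : Pt) :
    Continuous (fun q => fderiv ℝ h q v) :=
  (hs.continuous_fderiv (by simp)).clm_apply continuous_const

lemma smoothT_bound : ∃ M > 0, ∀ x : ℝ, |deriv Real.smoothTransition x| ≤ M := by
  have hsm : ContDiff ℝ 1 Real.smoothTransition := Real.smoothTransition.contDiff
  have hc : Continuous (deriv Real.smoothTransition) := hsm.continuous_deriv le_rfl
  obtain ⟨C, hC⟩ := (isCompact_Icc (a := (0:ℝ)) (b := 1)).exists_bound_of_continuousOn hc.continuousOn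
  refine ⟨max C 1, by positivity, fun x => ?_⟩
  by_cases hx : x ∈ Icc (0:ℝ) 1
  · exact (hC x hx).trans (le_max_left _ _)
  · have : deriv Real.smoothTransition x = 0 := by
      rw [mem_Icc, not_and_or, not_le, not_le] at hx
      rcases hx with hx | hx
      · apply IsLocalMin.deriv_eq_zero
        apply Filter.Eventually.of_forall
        intro y
        rw [Real.smoothTransition.zero_of_nonpos hx.le]
        exact Real.smoothTransition.nonneg y
      · apply IsLocalMax.deriv_eq_zero
        apply Filter.Eventually.of_forall
        intro y
        rw [Real.smoothTransition.one_of_one_le hx.le]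
        exact Real.smoothTransition.le_one y
    rw [this]; simp

lemma exists_cutoff (ε b : ℝ) (hε : 0 < ε) (hb : 0 < b) :
    ∃ a, 0 < a ∧ a < b ∧ ∃ χ g : Pt → ℝ, ContDiff ℝ (⊤ : ℕ∞) χ ∧
      (∀ q, 0 ≤ χ q ∧ χ q ≤ 1) ∧ (∀ q, usq q ≤ a → χ q = 1 ∧ g q = 0) ∧
      (∀ q, b ≤ usq q → χ q = 0 ∧ g q = 0) ∧
      (∀ q : Pt, ∀ t, χ (t, q.2) = χ q) ∧
      (∀ q v : Pt, fderiv ℝ χ q v = g q * (q.2.1 * v.2.1 + q.2.2 * v.2.2)) ∧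
      (∀ q, |usq q * g q| ≤ ε) := by
  obtain ⟨M, hM, hMb⟩ := smoothT_bound
  set c := ε / (2 * M) with hc
  have hc0 : 0 < c := by positivity
  set κ := b * Real.exp (-(1 / c)) / 2 with hκ
  have hκ0 : 0 < κ := by positivity
  have he1 : Real.exp (-(1 / c)) < 1 := by
    rw [Real.exp_lt_one_iff]; have : 0 < 1 / c := by positivity
    linarith
  set L : Pt → ℝ := fun q => c * (Real.log b - Real.log (usq q + κ)) with hL
  have hpos : ∀ q, 0 < usq q + κ := fun q => by have := usq_nonneg q; linarith
  set χ : Pt → ℝ := fun q => Real.smoothTransition (L q) with hχ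
  set g : Pt → ℝ := fun q => -(2 * c) * deriv Real.smoothTransition (L q) / (usq q + κ) with hg
  have hu : ContDiff ℝ (⊤ : ℕ∞) (fun q : Pt => usq q + κ) := by unfold usq; fun_prop
  have hsm : ContDiff ℝ (⊤ : ℕ∞) χ := by
    apply Real.smoothTransition.contDiff.comp
    exact contDiff_const.mul (contDiff_const.sub (hu.log (fun q => (hpos q).ne')))
  refine ⟨κ, hκ0, by rw [hκ]; nlinarith, χ, g, hsm,
    fun q => ⟨Real.smoothTransition.nonneg _, Real.smoothTransition.le_one _⟩, ?_, ?_, ?_, ?_, ?_⟩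
  · intro q hq
    have h1 : 1 ≤ L q := by
      have : Real.log (usq q + κ) ≤ Real.log b + -(1 / c) := by
        rw [← Real.log_exp (-(1 / c)), ← Real.log_mul hb.ne' (Real.exp_pos _).ne']
        apply Real.log_le_log (hpos q)
        have : b * Real.exp (-(1 / c)) = 2 * κ := by rw [hκ]; ring
        rw [this]; linarith
      have h2 : c * (1 / c) ≤ c * (Real.log b - Real.log (usq q + κ)) :=
        mul_le_mul_of_nonneg_left (by linarith) hc0.le
      rwa [mul_one_div_cancel hc0.ne'] at h2
    have h2 : χ q = 1 := Real.smoothTransition.one_of_one_le h1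
    refine ⟨h2, ?_⟩
    have : deriv Real.smoothTransition (L q) = 0 := by
      apply IsLocalMax.deriv_eq_zero
      apply Filter.Eventually.of_forall
      intro y
      rw [Real.smoothTransition.one_of_one_le h1]
      exact Real.smoothTransition.le_one y
    simp [hg, this]
  · intro q hq
    have h1 : L q ≤ 0 := by
      have : Real.log b ≤ Real.log (usq q + κ) := Real.log_le_log hb (by linarith)
      exact mul_nonpos_of_nonneg_of_nonpos hc0.le (by linarith)
    have h2 : χ q = 0 := Real.smoothTransition.zero_of_nonpos h1
    refine ⟨h2, ?_⟩
    have : deriv Real.smoothTransition (L q) = 0 := by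
      apply IsLocalMin.deriv_eq_zero
      apply Filter.Eventually.of_forall
      intro y
      rw [Real.smoothTransition.zero_of_nonpos h1]
      exact Real.smoothTransition.nonneg y
    simp [hg, this]
  · intro q t; rfl
  · intro q v
    have hx : HasFDerivAt (fun q : Pt => q.2.1)
        ((ContinuousLinearMap.fst ℝ ℝ ℝ).comp (ContinuousLinearMap.snd ℝ ℝ (ℝ × ℝ))) q :=
      ((ContinuousLinearMap.fst ℝ ℝ ℝ).comp (ContinuousLinearMap.snd ℝ ℝ (ℝ × ℝ))).hasFDerivAt
    have hy : HasFDerivAt (fun q : Pt => q.2.2)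
        ((ContinuousLinearMap.snd ℝ ℝ ℝ).comp (ContinuousLinearMap.snd ℝ ℝ (ℝ × ℝ))) q :=
      ((ContinuousLinearMap.snd ℝ ℝ ℝ).comp (ContinuousLinearMap.snd ℝ ℝ (ℝ × ℝ))).hasFDerivAt
    have hus := (((hx.pow 2).add (hy.pow 2)).add_const κ)
    have hlog := ((hus.log (hpos q).ne').const_sub (Real.log b)).const_mul c
    have hst : HasDerivAt Real.smoothTransition (deriv Real.smoothTransition (L q)) (L q) := by
      apply DifferentiableAt.hasDerivAt
      exact (Real.smoothTransition.contDiff (n := 1)).differentiable (by simp) _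
    have hfin := hst.comp_hasFDerivAt q hlog
    have h3 : fderiv ℝ χ q = _ := hfin.fderiv
    rw [h3]
    have := (hpos q).ne'
    have e : q.2.1 ^ 2 + q.2.2 ^ 2 + κ = usq q + κ := rfl
    simp [hg, e]
    field_simp
    ring
  · intro q
    have h1 : |usq q / (usq q + κ)| ≤ 1 := by
      rw [abs_of_nonneg (div_nonneg (usq_nonneg q) (hpos q).le), div_le_one (hpos q)]; linarith
    have e : usq q * g q = -(2 * c) * deriv Real.smoothTransition (L q) * (usq q / (usq q + κ)) := by
      simp only [hg]; ring
    rw [e, abs_mul, abs_mul, abs_neg, abs_of_pos (by positivity : 0 < 2 * c)]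
    have h2 := hMb (L q)
    have h3 : 2 * c * M = ε := by rw [hc]; field_simp
    calc _ ≤ 2 * c * |deriv Real.smoothTransition (L q)| * 1 := by gcongr
      _ ≤ 2 * c * M * 1 := by gcongr
      _ = ε := by rw [h3, mul_one]

lemma wedge_formula (c : Pt → Pt) (f : Pt → ℝ) (hf : Differentiable ℝ f) (q : Pt) :
    wedgeD c (fun x => f x • alphaSt x) q =
      (c q).1 * (2 * f q + q.2.1 * pdX f q + q.2.2 * pdY f q)
      - (c q).2.1 * (q.2.1 * pdA f q - pdY f q)
      + (c q).2.2 * (- q.2.2 * pdA f q - pdX f q) := by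
  have hx : HasFDerivAt (fun q : Pt => q.2.1)
      ((ContinuousLinearMap.fst ℝ ℝ ℝ).comp (ContinuousLinearMap.snd ℝ ℝ (ℝ × ℝ))) q :=
    ((ContinuousLinearMap.fst ℝ ℝ ℝ).comp (ContinuousLinearMap.snd ℝ ℝ (ℝ × ℝ))).hasFDerivAt
  have hy : HasFDerivAt (fun q : Pt => q.2.2)
      ((ContinuousLinearMap.snd ℝ ℝ ℝ).comp (ContinuousLinearMap.snd ℝ ℝ (ℝ × ℝ))) q :=
    ((ContinuousLinearMap.snd ℝ ℝ ℝ).comp (ContinuousLinearMap.snd ℝ ℝ (ℝ × ℝ))).hasFDerivAt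
  have hfq := (hf q).hasFDerivAt
  have h1 := (hfq.mul hx).fderiv
  have h2 := (hfq.mul hy.neg).fderiv
  have e1 : (fun p : Pt => (f p • alphaSt p).1) = f := by funext p; simp [alphaSt]
  have e2 : (fun p : Pt => (f p • alphaSt p).2.1) = f * (-fun q : Pt => q.2.2) := by
    funext p; simp [alphaSt]
  have e3 : (fun p : Pt => (f p • alphaSt p).2.2) = f * (fun q : Pt => q.2.1) := by
    funext p; simp [alphaSt]
  unfold wedgeD
  rw [e1, e2, e3]
  simp only [pdA, pdX, pdY, h1, h2]
  simp [-mul_eq_mul_left_iff, -mul_eq_mul_right_iff]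
  ring_nf
  try simp

lemma mix_fderiv (p r χ : Pt → ℝ) (hp : Differentiable ℝ p) (hr : Differentiable ℝ r)
    (hχ : Differentiable ℝ χ) (q v : Pt) :
    fderiv ℝ (fun q => p q + χ q * r q) q v =
      fderiv ℝ p q v + χ q * fderiv ℝ r q v + fderiv ℝ χ q v * r q := by
  have h := ((hp q).hasFDerivAt.add ((hχ q).hasFDerivAt.mul (hr q).hasFDerivAt)).fderiv
  have e : (fun q => p q + χ q * r q) = p + χ * r := rfl
  rw [e, h]
  simp
  ring

lemma core_fderiv (p : Pt → ℝ) (hp : Differentiable ℝ p) (q v : Pt) :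
    fderiv ℝ (fun q : Pt => p (q.1, 0, 0)) q v = v.1 * pdA p (q.1, 0, 0) := by
  have h0 : HasFDerivAt (fun q : Pt => ((q.1, 0, 0) : Pt))
      ((ContinuousLinearMap.fst ℝ ℝ (ℝ × ℝ)).prod 0) q :=
    ((ContinuousLinearMap.fst ℝ ℝ (ℝ × ℝ)).hasFDerivAt).prodMk (hasFDerivAt_const _ _)
  have h := ((hp (q.1, 0, 0)).hasFDerivAt.comp q h0).fderiv
  have e : (fun q : Pt => p (q.1, 0, 0)) = p ∘ (fun q : Pt => ((q.1, 0, 0) : Pt)) := rfl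
  rw [e, h]
  have h5 : ((v.1, 0, 0) : Pt) = v.1 • ((1, 0, 0) : Pt) := by ext <;> simp
  show fderiv ℝ p (q.1, 0, 0) (v.1, 0, 0) = _
  rw [h5, map_smul]
  rfl

lemma core_pos (p : Pt → ℝ) (hp : ContDiff ℝ (⊤ : ℕ∞) p) (n : ℕ) (hn : 0 < n)
    (hpe : ∀ q : Pt, p (q.1 + 2 * π, q.2) = p q + 2 * π * n)
    (hc : ∀ t : ℝ, pdA p (t, 0, 0) ≠ 0) (t : ℝ) : 0 < pdA p (t, 0, 0) := by
  have hpd : Differentiable ℝ p := hp.differentiable (by simp)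
  have hcont : Continuous (fun t : ℝ => pdA p (t, 0, 0)) :=
    (cont_fderiv p hp (1, 0, 0)).comp (by fun_prop)
  have hder : ∀ s : ℝ, HasDerivAt (fun s : ℝ => p (s, 0, 0)) (pdA p (s, 0, 0)) s := by
    intro s
    have h0 : HasDerivAt (fun s : ℝ => ((s, 0, 0) : Pt)) (1, 0, 0) s :=
      (hasDerivAt_id s).prodMk (hasDerivAt_const s _)
    exact (hpd (s, 0, 0)).hasFDerivAt.comp_hasDerivAt s h0
  obtain ⟨s, -, hs⟩ := exists_hasDerivAt_eq_slope (fun s : ℝ => p (s, 0, 0)) _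
    (show (0:ℝ) < 2 * π by positivity)
    (fun x _ => (hder x).continuousAt.continuousWithinAt) (fun x _ => hder x)
  have hs0 : 0 < pdA p (s, 0, 0) := by
    rw [hs]
    have := hpe (0, 0, 0)
    simp only [zero_add] at this
    simp only [this]
    have hn' : (0:ℝ) < n := by exact_mod_cast hn
    have : 0 < 2 * π * n := by positivity
    have h2 : (0:ℝ) < 2 * π - 0 := by simpa using Real.pi_pos
    apply div_pos _ h2
    linarith
  by_contra hlt
  rw [not_lt] at hlt
  obtain ⟨r, hr⟩ := mem_range_of_exists_le_of_exists_ge hcont ⟨t, hlt⟩ ⟨s, hs0.le⟩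
  exact hc r hr

/-- **Standardization of an open book projection and contact form near a transverse
knot.** On the solid torus `V = S¹ × D²_δ` (angle `θ` of period `2π`), let
`α = f·(dθ + r²dφ)` be a positive contact form defining the standard contact
structure `ξ_st` (`f > 0`), and let `π : V → S¹` be a submersion — encoded by a
lift `p : ℝ³ → ℝ` with `p(θ+2π,x,y) = p(θ,x,y) + 2πn` — with `dπ∧dα > 0`, whose
restriction to the core circle `K = {r = 0}` is a covering of degree `n` (the lift
has nonvanishing `θ`-derivative along `K`). Then there exist a submersion
`π' : V → S¹` (encoded by a lift `p'`) agreeing with `π` near `∂V` and equal to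
`nθ` near `K`, and a positive contact form `α' = f'·(dθ + r²dφ)` defining `ξ_st`
with `dπ'∧dα' > 0`, coinciding with `α` near `∂V` and with `dθ + r²dφ` near `K`. -/
theorem stmt_1 (δ : ℝ) (hδ : 0 < δ) (n : ℕ) (hn : 0 < n)
    (f : Pt → ℝ) (hfsm : ContDiff ℝ (⊤ : ℕ∞) f) (hfper : IsPeriodic (2 * π) f)
    (hfpos : ∀ q ∈ Vset δ, 0 < f q)
    (hcontact : ∀ q ∈ Vset δ, 0 < wedgeD (fun x => f x • alphaSt x) (fun x => f x • alphaSt x) q)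
    (p : Pt → ℝ) (hpsm : ContDiff ℝ (⊤ : ℕ∞) p)
    (hpequiv : ∀ q : Pt, p (q.1 + 2 * π, q.2) = p q + 2 * π * n)
    (hpsub : ∀ q ∈ Vset δ, gradOf p q ≠ 0)
    (hpcover : ∀ θ : ℝ, pdA p (θ, 0, 0) ≠ 0)
    (hpwedge : ∀ q ∈ Vset δ, 0 < wedgeD (gradOf p) (fun x => f x • alphaSt x) q) :
    ∃ p' f' : Pt → ℝ,
      ContDiff ℝ (⊤ : ℕ∞) p' ∧ (∀ q : Pt, p' (q.1 + 2 * π, q.2) = p' q + 2 * π * n) ∧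
      (∀ q ∈ Vset δ, gradOf p' q ≠ 0) ∧
      ContDiff ℝ (⊤ : ℕ∞) f' ∧ IsPeriodic (2 * π) f' ∧ (∀ q ∈ Vset δ, 0 < f' q) ∧
      (∀ q ∈ Vset δ,
        0 < wedgeD (fun x => f' x • alphaSt x) (fun x => f' x • alphaSt x) q) ∧
      (∀ q ∈ Vset δ, 0 < wedgeD (gradOf p') (fun x => f' x • alphaSt x) q) ∧
      (∃ δ₁ ∈ Ioo 0 δ, ∀ q ∈ Vset δ, δ₁ ≤ rad q → p' q = p q ∧ f' q = f q) ∧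
      (∃ η > 0, ∀ q ∈ Vset δ, rad q ≤ η → p' q = n * q.1 ∧ f' q = 1) := by
  have hfd : Differentiable ℝ f := hfsm.differentiable (by simp)
  have hpd : Differentiable ℝ p := hpsm.differentiable (by simp)
  have hnR : (0:ℝ) < n := by exact_mod_cast hn
  have hcore := core_pos p hpsm n hn hpequiv hpcover
  have hf0 : ∀ q : Pt, f (q.1 + 2 * π, q.2) = f q + 0 := fun q => by rw [add_zero]; exact hfper q
  have hfsh := fderiv_shift f _ _ hf0
  have hpsh := fderiv_shift p _ _ hpequiv
  have cfA : Continuous (pdA f) := cont_fderiv f hfsm _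
  have cfX : Continuous (pdX f) := cont_fderiv f hfsm _
  have cfY : Continuous (pdY f) := cont_fderiv f hfsm _
  have cpA : Continuous (pdA p) := cont_fderiv p hpsm _
  have cpX : Continuous (pdX p) := cont_fderiv p hpsm _
  have cpY : Continuous (pdY p) := cont_fderiv p hpsm _
  have cf : Continuous f := hfsm.continuous
  have pfA : IsPeriodic (2 * π) (pdA f) := fun q => by unfold pdA; rw [hfsh]
  have pfX : IsPeriodic (2 * π) (pdX f) := fun q => by unfold pdX; rw [hfsh]
  have pfY : IsPeriodic (2 * π) (pdY f) := fun q => by unfold pdY; rw [hfsh]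
  have ppA : IsPeriodic (2 * π) (pdA p) := fun q => by unfold pdA; rw [hpsh]
  have ppX : IsPeriodic (2 * π) (pdX p) := fun q => by unfold pdX; rw [hpsh]
  have ppY : IsPeriodic (2 * π) (pdY p) := fun q => by unfold pdY; rw [hpsh]
  -- the quantities to be bounded below
  set G1 : Pt → ℝ := fun q => pdA p q * (2 * f q + q.2.1 * pdX f q + q.2.2 * pdY f q)
      - pdX p q * (q.2.1 * pdA f q - pdY f q)
      + pdY p q * (- q.2.2 * pdA f q - pdX f q) with hG1
  set G2 : Pt → ℝ := fun q => 2 * f q + q.2.1 * pdX f q + q.2.2 * pdY f q with hG2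
  set G3 : Pt → ℝ := fun q => pdA p (q.1, 0, 0) * G2 q with hG3
  have hW1 : ∀ q ∈ Vset δ, 0 < G1 q := by
    intro q hq
    have := hpwedge q hq
    rw [wedge_formula _ _ hfd] at this
    exact this
  have hmem0 : ∀ t : ℝ, ((t, 0, 0) : Pt) ∈ Vset δ := fun t => by
    show (0:ℝ) ^ 2 + 0 ^ 2 ≤ δ ^ 2
    nlinarith [sq_nonneg δ]
  have cG2 : Continuous G2 := by rw [hG2]; fun_prop
  have cG1 : Continuous G1 := by rw [hG1]; fun_prop
  have cG3 : Continuous G3 := by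
    rw [hG3]; exact (cpA.comp (by fun_prop)).mul cG2
  have pG2 : IsPeriodic (2 * π) G2 := fun q => by
    simp only [hG2, hfper q, pfX q, pfY q]
  have pG1 : IsPeriodic (2 * π) G1 := fun q => by
    simp only [hG1, hfper q, pfX q, pfY q, pfA q, ppX q, ppY q, ppA q]
  have pG3 : IsPeriodic (2 * π) G3 := fun q => by
    have := ppA (q.1, 0, 0)
    simp only [hG3, pG2 q]
    simp only at this
    rw [this]
  have G2core : ∀ t : ℝ, 0 < G2 (t, 0, 0) := fun t => by
    have := hfpos _ (hmem0 t)
    simp [hG2]; linarith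
  obtain ⟨β1, hβ1, m1, hm1, hl1⟩ := exists_lower G1 cG1 pG1 (fun t => hW1 _ (hmem0 t))
  obtain ⟨β2, hβ2, m2, hm2, hl2⟩ := exists_lower G2 cG2 pG2 G2core
  obtain ⟨β3, hβ3, m3, hm3, hl3⟩ := exists_lower G3 cG3 pG3 (fun t => mul_pos (hcore t) (G2core t))
  obtain ⟨CA, hCA, bA⟩ := exists_bound (pdA f) cfA pfA
  obtain ⟨CX, hCX, bX⟩ := exists_bound (pdX f) cfX pfX
  obtain ⟨CY, hCY, bY⟩ := exists_bound (pdY f) cfY pfY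
  obtain ⟨CF, hCF, bF⟩ := exists_bound f cf hfper
  obtain ⟨CP, hCP, bP⟩ := exists_bound (fun q => ‖fderiv ℝ p q‖)
    (hpsm.continuous_fderiv (by simp)).norm (fun q => by simp only [hpsh])
  have hlip : ∀ q : Pt, ‖q.2‖ ≤ 1 → |p (q.1, 0, 0) - p q| ≤ CP * ‖q.2‖ := by
    intro q hq
    have hconv : Convex ℝ ((univ : Set ℝ) ×ˢ (Metric.closedBall (0 : ℝ × ℝ) 1)) :=
      convex_univ.prod (convex_closedBall _ _)
    have := hconv.norm_image_sub_le_of_norm_fderiv_le (𝕜 := ℝ) (f := p) (C := CP)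
      (fun x _ => hpd x) (fun x hx => by
        have := bP x (by simpa using hx.2)
        rwa [abs_of_nonneg (norm_nonneg _)] at this)
      (x := q) (y := (q.1, 0, 0)) ⟨mem_univ _, by simpa using hq⟩
      ⟨mem_univ _, by simp [← Prod.zero_eq_mk]⟩
    have e : ‖((q.1, 0, 0) : Pt) - q‖ = ‖q.2‖ := by
      rw [show ((q.1, 0, 0) : Pt) - q = (0, -q.2) by ext <;> simp]
      rw [Prod.norm_def]; simp
    rwa [e, Real.norm_eq_abs] at this
  set D := CP * (2 * CA + CX + CY) with hD
  have hD0 : 0 < D := by positivity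
  have herr : ∀ q : Pt, usq q ≤ 1 → |(p (q.1, 0, 0) - p q) *
      (- usq q * pdA f q + q.2.1 * pdY f q - q.2.2 * pdX f q)| ≤ D * usq q := by
    intro q hq
    have hs := norm_le_one_of_usq q hq
    have hss := norm_sq_le_usq q
    have hx : |q.2.1| ≤ ‖q.2‖ := norm_fst_le q.2
    have hy : |q.2.2| ≤ ‖q.2‖ := norm_snd_le q.2
    have hs0 := norm_nonneg q.2
    have hu2 : |usq q| ≤ 2 * ‖q.2‖ := by
      rw [abs_of_nonneg (usq_nonneg q)]
      unfold usq
      have h1 : q.2.1 ^ 2 ≤ ‖q.2‖ ^ 2 := by rw [← sq_abs q.2.1]; gcongr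
      have h2 : q.2.2 ^ 2 ≤ ‖q.2‖ ^ 2 := by rw [← sq_abs q.2.2]; gcongr
      nlinarith
    have t1 : |(- usq q * pdA f q)| ≤ 2 * ‖q.2‖ * CA := by
      rw [abs_mul, abs_neg]; have := bA q hs; gcongr
    have t2 : |q.2.1 * pdY f q| ≤ ‖q.2‖ * CY := by
      rw [abs_mul]; have := bY q hs; gcongr
    have t3 : |q.2.2 * pdX f q| ≤ ‖q.2‖ * CX := by
      rw [abs_mul]; have := bX q hs; gcongr
    have t : |(- usq q * pdA f q + q.2.1 * pdY f q - q.2.2 * pdX f q)|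
        ≤ ‖q.2‖ * (2 * CA + CX + CY) := by
      have a1 := abs_sub (- usq q * pdA f q + q.2.1 * pdY f q) (q.2.2 * pdX f q)
      have a2 := abs_add_le (- usq q * pdA f q) (q.2.1 * pdY f q)
      linarith
    rw [abs_mul]
    calc _ ≤ (CP * ‖q.2‖) * (‖q.2‖ * (2 * CA + CX + CY)) := by
          have := hlip q hs
          gcongr
      _ = D * ‖q.2‖ ^ 2 := by rw [hD]; ring
      _ ≤ D * usq q := by gcongr
  -- choice of the cutoffs
  set m := min m1 m3 with hm
  have hm0 : 0 < m := lt_min hm1 hm3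
  set b1 := min (min β1 β3) (min 1 (δ ^ 2 / 2)) with hb1
  have hb10 : 0 < b1 := lt_min (lt_min hβ1 hβ3) (lt_min one_pos (by positivity))
  have hb1a : b1 ≤ β1 := (min_le_left _ _).trans (min_le_left _ _)
  have hb1b : b1 ≤ β3 := (min_le_left _ _).trans (min_le_right _ _)
  have hb1c : b1 ≤ 1 := (min_le_right _ _).trans (min_le_left _ _)
  have hb1d : b1 ≤ δ ^ 2 / 2 := (min_le_right _ _).trans (min_le_right _ _)
  obtain ⟨a1, ha1, hab1, χ1, g1, sχ1, rχ1, iχ1, oχ1, tχ1, dχ1, eχ1⟩ :=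
    exists_cutoff (m / (2 * D)) b1 (by positivity) hb10
  set m' := min m2 2 with hm'
  have hm'0 : 0 < m' := lt_min hm2 two_pos
  set b2 := min a1 β2 with hb2
  have hb20 : 0 < b2 := lt_min ha1 hβ2
  have hb2a : b2 ≤ a1 := min_le_left _ _
  have hb2b : b2 ≤ β2 := min_le_right _ _
  obtain ⟨a2, ha2, hab2, χ2, g2, sχ2, rχ2, iχ2, oχ2, tχ2, dχ2, eχ2⟩ :=
    exists_cutoff (m' / (2 * (1 + CF))) b2 (by positivity) hb20
  obtain ⟨a3, ha3, hab3, χ3, g3, sχ3, rχ3, iχ3, oχ3, tχ3, dχ3, eχ3⟩ :=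
    exists_cutoff 1 a2 one_pos ha2
  set p0 : Pt → ℝ := fun q => p (q.1, 0, 0) with hp0
  have sp0 : ContDiff ℝ (⊤ : ℕ∞) p0 := hpsm.comp (by fun_prop)
  have sl : ContDiff ℝ (⊤ : ℕ∞) (fun q : Pt => (n : ℝ) * q.1) := by fun_prop
  set pA : Pt → ℝ := fun q => p q + χ1 q * (p0 q - p q) with hpA
  have spA : ContDiff ℝ (⊤ : ℕ∞) pA := hpsm.add (sχ1.mul (sp0.sub hpsm))
  set p' : Pt → ℝ := fun q => pA q + χ3 q * ((n : ℝ) * q.1 - p0 q) with hp'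
  have sp' : ContDiff ℝ (⊤ : ℕ∞) p' := spA.add (sχ3.mul (sl.sub sp0))
  set f' : Pt → ℝ := fun q => f q + χ2 q * (1 - f q) with hf'
  have sf' : ContDiff ℝ (⊤ : ℕ∞) f' := hfsm.add (sχ2.mul (contDiff_const.sub hfsm))
  have df : ∀ {h : Pt → ℝ}, ContDiff ℝ (⊤ : ℕ∞) h → Differentiable ℝ h :=
    fun h => h.differentiable (by simp)
  have Df' : ∀ q v : Pt, fderiv ℝ f' q v = (1 - χ2 q) * fderiv ℝ f q v
      + g2 q * (q.2.1 * v.2.1 + q.2.2 * v.2.2) * (1 - f q) := by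
    intro q v
    rw [hf', mix_fderiv f (fun q => 1 - f q) χ2 hfd (by fun_prop) (df sχ2), dχ2,
      fderiv_const_sub]
    simp only [ContinuousLinearMap.neg_apply]
    ring
  have Dl : ∀ q v : Pt, fderiv ℝ (fun q : Pt => (n : ℝ) * q.1) q v = n * v.1 := by
    intro q v
    have h := ((ContinuousLinearMap.fst ℝ ℝ (ℝ × ℝ)).hasFDerivAt (x := q)).const_mul (n : ℝ)
    have h2 : fderiv ℝ (fun q : Pt => (n : ℝ) * q.1) q = _ := h.fderiv
    rw [h2]; simp
  have Dp' : ∀ q v : Pt, fderiv ℝ p' q v = (1 - χ1 q) * fderiv ℝ p q v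
      + χ1 q * (v.1 * pdA p (q.1, 0, 0))
      + g1 q * (q.2.1 * v.2.1 + q.2.2 * v.2.2) * (p0 q - p q)
      + χ3 q * (n * v.1 - v.1 * pdA p (q.1, 0, 0))
      + g3 q * (q.2.1 * v.2.1 + q.2.2 * v.2.2) * (n * q.1 - p0 q) := by
    intro q v
    rw [hp', mix_fderiv pA (fun q => (n : ℝ) * q.1 - p0 q) χ3 (df spA)
      ((df sl).sub (df sp0)) (df sχ3), dχ3, fderiv_fun_sub (df sl q) (df sp0 q), hpA,
      mix_fderiv p (fun q => p0 q - p q) χ1 hpd ((df sp0).sub hpd) (df sχ1), dχ1,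
      fderiv_fun_sub (df sp0 q) (hpd q)]
    simp only [ContinuousLinearMap.sub_apply, Dl]
    rw [hp0, core_fderiv p hpd]
    ring
  have A' : ∀ q, pdA p' q = (1 - χ1 q) * pdA p q + χ1 q * pdA p (q.1, 0, 0)
      + χ3 q * (n - pdA p (q.1, 0, 0)) := fun q => by
    have := Dp' q (1, 0, 0)
    simp only [mul_zero, add_zero, zero_mul, one_mul, mul_one] at this
    exact this
  have X' : ∀ q, pdX p' q = (1 - χ1 q) * pdX p q + g1 q * q.2.1 * (p0 q - p q)
      + g3 q * q.2.1 * (n * q.1 - p0 q) := fun q => by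
    have := Dp' q (0, 1, 0)
    simp only [mul_zero, add_zero, zero_mul, mul_one, sub_zero] at this
    exact this
  have Y' : ∀ q, pdY p' q = (1 - χ1 q) * pdY p q + g1 q * q.2.2 * (p0 q - p q)
      + g3 q * q.2.2 * (n * q.1 - p0 q) := fun q => by
    have := Dp' q (0, 0, 1)
    simp only [mul_zero, add_zero, zero_add, zero_mul, mul_one, sub_zero] at this
    exact this
  have fA' : ∀ q, pdA f' q = (1 - χ2 q) * pdA f q := fun q => by
    have := Df' q (1, 0, 0)
    simp only [mul_zero, add_zero, zero_mul] at this
    exact this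
  have fX' : ∀ q, pdX f' q = (1 - χ2 q) * pdX f q + g2 q * q.2.1 * (1 - f q) := fun q => by
    have := Df' q (0, 1, 0)
    simp only [mul_zero, add_zero, mul_one] at this
    exact this
  have fY' : ∀ q, pdY f' q = (1 - χ2 q) * pdY f q + g2 q * q.2.2 * (1 - f q) := fun q => by
    have := Df' q (0, 0, 1)
    simp only [mul_zero, zero_add, mul_one] at this
    exact this
  have f'pos : ∀ q ∈ Vset δ, 0 < f' q := by
    intro q hq
    have h1 := hfpos q hq
    obtain ⟨h2, h3⟩ := rχ2 q
    have e : f' q = (1 - χ2 q) * f q + χ2 q := by simp only [hf']; ring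
    rw [e]
    rcases h3.lt_or_eq with h | h
    · have : 0 < (1 - χ2 q) * f q := mul_pos (by linarith) h1
      linarith
    · rw [h]; norm_num
  have hwedge : ∀ q ∈ Vset δ, 0 < wedgeD (gradOf p') (fun x => f' x • alphaSt x) q := by
    intro q hq
    rw [wedge_formula _ _ (df sf')]
    simp only [gradOf, A', X', Y', fA', fX', fY']
    rcases le_total b2 (usq q) with hu | hu
    · -- region A
      obtain ⟨z2, y2⟩ := oχ2 q hu
      obtain ⟨z3, y3⟩ := oχ3 q (hab2.le.trans hu)
      have ef : f' q = f q := by simp [hf', z2]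
      rw [ef, z2, y2, z3, y3]
      have key : (1 - χ1 q) * G1 q + χ1 q * G3 q + g1 q * ((p (q.1, 0, 0) - p q) *
          (- usq q * pdA f q + q.2.1 * pdY f q - q.2.2 * pdX f q)) > 0 := by
        rcases le_total b1 (usq q) with hv | hv
        · obtain ⟨z1, y1⟩ := oχ1 q hv
          rw [z1, y1]
          have := hW1 q hq
          linarith
        · have k1 : m ≤ G1 q := (min_le_left _ _).trans (hl1 q (hv.trans hb1a))
          have k3 : m ≤ G3 q := (min_le_right _ _).trans (hl3 q (hv.trans hb1b))
          have k := herr q (hv.trans hb1c)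
          obtain ⟨r1, r2⟩ := rχ1 q
          have c1 : (1 - χ1 q) * m ≤ (1 - χ1 q) * G1 q :=
            mul_le_mul_of_nonneg_left k1 (by linarith)
          have c2 : χ1 q * m ≤ χ1 q * G3 q := mul_le_mul_of_nonneg_left k3 r1
          have c3 : |g1 q * ((p (q.1, 0, 0) - p q) *
              (- usq q * pdA f q + q.2.1 * pdY f q - q.2.2 * pdX f q))| ≤ m / 2 := by
            rw [abs_mul]
            have e1 := eχ1 q
            rw [abs_mul, abs_of_nonneg (usq_nonneg q)] at e1
            calc _ ≤ |g1 q| * (D * usq q) := by gcongr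
              _ = D * (usq q * |g1 q|) := by ring
              _ ≤ D * (m / (2 * D)) := by gcongr
              _ = m / 2 := by field_simp
          have c4 := neg_le_of_abs_le c3
          linarith
      convert key using 1
      simp only [hG1, hG3, hG2, hp0, usq]
      ring
    · obtain ⟨z1, y1⟩ := iχ1 q (hu.trans hb2a)
      have hc := hcore q.1
      rcases le_total a2 (usq q) with hv | hv
      · -- region B
        obtain ⟨z3, y3⟩ := oχ3 q hv
        rw [z1, y1, z3, y3]
        have key : 0 < (1 - χ2 q) * G2 q + χ2 q * 2 + (usq q * g2 q) * (1 - f q) := by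
          have k2 : m' ≤ G2 q := (min_le_left _ _).trans (hl2 q (hu.trans hb2b))
          have k3 : m' ≤ 2 := min_le_right _ _
          obtain ⟨r1, r2⟩ := rχ2 q
          have c1 : (1 - χ2 q) * m' ≤ (1 - χ2 q) * G2 q :=
            mul_le_mul_of_nonneg_left k2 (by linarith)
          have c2 : χ2 q * m' ≤ χ2 q * 2 := mul_le_mul_of_nonneg_left k3 r1
          have c3 : |(usq q * g2 q) * (1 - f q)| ≤ m' / 2 := by
            rw [abs_mul]
            have e1 := eχ2 q
            have e2 : |1 - f q| ≤ 1 + CF := by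
              have a := abs_sub (1:ℝ) (f q)
              have b := bF q (norm_le_one_of_usq q (by linarith))
              rw [abs_one] at a
              linarith
            calc _ ≤ (m' / (2 * (1 + CF))) * (1 + CF) := by gcongr
              _ = m' / 2 := by field_simp
          have c4 := neg_le_of_abs_le c3
          linarith
        refine lt_of_lt_of_eq (mul_pos hc key) ?_
        simp only [hG2, hf', usq]
        ring
      · -- region C
        obtain ⟨z2, y2⟩ := iχ2 q hv
        have ef : f' q = 1 := by simp [hf', z2]
        rw [ef, z1, y1, z2, y2]
        obtain ⟨r1, r2⟩ := rχ3 q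
        have key : 0 < (1 - χ3 q) * pdA p (q.1, 0, 0) + χ3 q * n := by
          rcases r2.lt_or_eq with h | h
          · have h1 : 0 < (1 - χ3 q) * pdA p (q.1, 0, 0) := mul_pos (by linarith) hc
            have h2 : 0 ≤ χ3 q * n := by positivity
            linarith
          · rw [h]; linarith
        nlinarith [key]
  refine ⟨p', f', sp', ?_, ?_, sf', ?_, f'pos, ?_, hwedge, ?_, ?_⟩
  · intro q
    have h1 := hpequiv q
    have h2 := hpequiv (q.1, 0, 0)
    simp only at h2
    simp only [hp', hpA, hp0, h1, h2, tχ1 q, tχ3 q]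
    ring
  · intro q hq h0
    have h := hwedge q hq
    rw [wedge_formula _ _ (df sf'), h0] at h
    simp at h
  · intro q
    have h1 := hfper q
    have h2 := tχ2 q (q.1 + 2 * π)
    show f (q.1 + 2 * π, q.2) + χ2 (q.1 + 2 * π, q.2) * (1 - f (q.1 + 2 * π, q.2)) = _
    rw [h1, h2]
  · intro q hq
    rw [wedge_formula _ _ (df sf')]
    have := f'pos q hq
    have h2 : 0 < 2 * f' q ^ 2 := by positivity
    convert h2 using 1
    simp only [alphaSt, Prod.smul_fst, Prod.smul_snd, smul_eq_mul]
    ring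
  · refine ⟨Real.sqrt b1, ⟨Real.sqrt_pos.2 hb10, ?_⟩, ?_⟩
    · rw [Real.sqrt_lt' hδ]
      have : 0 < δ ^ 2 := by positivity
      linarith
    · intro q hq hr
      have hu : b1 ≤ usq q := (Real.sqrt_le_sqrt_iff (usq_nonneg q)).1 hr
      have z1 := (oχ1 q hu).1
      have z2 := (oχ2 q (by linarith)).1
      have z3 := (oχ3 q (by linarith)).1
      simp [hp', hpA, hf', z1, z2, z3]
  · refine ⟨Real.sqrt a3, Real.sqrt_pos.2 ha3, ?_⟩
    intro q hq hr
    have hu : usq q ≤ a3 := (Real.sqrt_le_sqrt_iff ha3.le).1 hr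
    have z1 := (iχ1 q (by linarith)).1
    have z2 := (iχ2 q (by linarith)).1
    have z3 := (iχ3 q hu).1
    simp [hp', hpA, hf', z1, z2, z3]
end

section
/- Let $V=S^1\times D^2_\delta$ be the solid torus with coordinate $\theta\in\mathbb{R}/2\pi\mathbb{Z}$ on $S^1$ and polar coordinates $(r,\phi)$ on the closed disk $D^2_\delta$. Let $\alpha_0,\alpha_1$ be two positive contact forms on $V$ defining the standard contact structure $\xi_{st}=\ker(d\theta+r^2d\phi)$, i.e. $\alpha_i=f_i\cdot(d\theta+r^2d\phi)$ with $f_i$ smooth and positive, and assume $d\theta\wedge d\alpha_i>0$ on $V$ for $i=0,1$. Then there exists a positive contact form $\alpha$ on $V$ defining $\xi_{st}$ with $d\theta\wedge d\alpha>0$, which coincides with $\alpha_0$ on a neighbourhood of $\partial V$ and with $\alpha_1$ on a neighbourhood of the core circle $S^1\times\{0\}$. -/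
open Set Real

noncomputable def EE (h : Pt → ℝ) (q : Pt) : ℝ := 2 * h q + fderiv ℝ h q (0, q.2.1, q.2.2)

lemma fderiv_dir (h : Pt → ℝ) (q : Pt) :
    fderiv ℝ h q (0, q.2.1, q.2.2) = q.2.1 * pdX h q + q.2.2 * pdY h q := by
  have : ((0, q.2.1, q.2.2) : Pt) = q.2.1 • ((0, 1, 0) : Pt) + q.2.2 • ((0, 0, 1) : Pt) := by
    ext <;> simp
  rw [this, map_add, map_smul, map_smul]
  rfl

lemma hx_deriv (q : Pt) : HasFDerivAt (fun p : Pt => p.2.1)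
    ((ContinuousLinearMap.fst ℝ ℝ ℝ).comp (ContinuousLinearMap.snd ℝ ℝ (ℝ × ℝ))) q :=
  ((ContinuousLinearMap.fst ℝ ℝ ℝ).comp (ContinuousLinearMap.snd ℝ ℝ (ℝ × ℝ))).hasFDerivAt

lemma hy_deriv (q : Pt) : HasFDerivAt (fun p : Pt => p.2.2)
    ((ContinuousLinearMap.snd ℝ ℝ ℝ).comp (ContinuousLinearMap.snd ℝ ℝ (ℝ × ℝ))) q :=
  ((ContinuousLinearMap.snd ℝ ℝ ℝ).comp (ContinuousLinearMap.snd ℝ ℝ (ℝ × ℝ))).hasFDerivAt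

lemma fd_x (f : Pt → ℝ) (hf : Differentiable ℝ f) (q v : Pt) :
    fderiv ℝ (fun p : Pt => f p * p.2.1) q v = f q * v.2.1 + q.2.1 * fderiv ℝ f q v := by
  have h : fderiv ℝ (fun p : Pt => f p * p.2.1) q = _ :=
    ((hf q).hasFDerivAt.mul (hx_deriv q)).fderiv
  rw [h]
  simp

lemma fd_y (f : Pt → ℝ) (hf : Differentiable ℝ f) (q v : Pt) :
    fderiv ℝ (fun p : Pt => f p * -p.2.2) q v = - (f q * v.2.2) - q.2.2 * fderiv ℝ f q v := by
  have h : fderiv ℝ (fun p : Pt => f p * -p.2.2) q = _ :=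
    ((hf q).hasFDerivAt.mul (hy_deriv q).neg).fderiv
  rw [h]
  simp
  ring

lemma wedge_one (f : Pt → ℝ) (hf : Differentiable ℝ f) (q : Pt) :
    wedgeD (fun _ => (1, 0, 0)) (fun x => f x • alphaSt x) q = EE f q := by
  simp only [wedgeD, EE, fderiv_dir, alphaSt, pdX, pdY, pdA, Prod.smul_mk, smul_eq_mul,
    fd_x f hf, fd_y f hf]
  ring

lemma wedge_self (f : Pt → ℝ) (hf : Differentiable ℝ f) (q : Pt) :
    wedgeD (fun x => f x • alphaSt x) (fun x => f x • alphaSt x) q = 2 * f q ^ 2 := by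
  simp only [wedgeD, alphaSt, pdX, pdY, pdA, Prod.smul_mk, smul_eq_mul,
    fd_x f hf, fd_y f hf, mul_one]
  ring

lemma exists_min (δ : ℝ) (h : Pt → ℝ) (hc : Continuous h)
    (hp : IsPeriodic (2 * π) h) : ∃ q₀ ∈ Vset δ, ∀ q ∈ Vset δ, h q₀ ≤ h q := by
  have hK : IsCompact (Icc (0:ℝ) (2 * π) ×ˢ {p : ℝ × ℝ | p.1 ^ 2 + p.2 ^ 2 ≤ δ ^ 2}) := by
    apply isCompact_Icc.prod
    apply IsCompact.of_isClosed_subset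
      ((isCompact_Icc (a := -|δ|) (b := |δ|)).prod (isCompact_Icc (a := -|δ|) (b := |δ|)))
    · exact isClosed_le (by fun_prop) (by fun_prop)
    · rintro ⟨a, b⟩ hab
      simp only [mem_setOf_eq] at hab
      have h1 : |a| ≤ |δ| := sq_le_sq.1 (by nlinarith [sq_nonneg b])
      have h2 : |b| ≤ |δ| := sq_le_sq.1 (by nlinarith [sq_nonneg a])
      exact ⟨abs_le.1 h1, abs_le.1 h2⟩
  obtain ⟨q₀, hq₀, hmin⟩ := hK.exists_isMinOn
    ⟨(0, 0, 0), ⟨⟨le_rfl, by positivity⟩, by simp; positivity⟩⟩ hc.continuousOn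
  refine ⟨q₀, hq₀.2, ?_⟩
  rintro ⟨t, p⟩ hq
  have hper : Function.Periodic (fun t => h (t, p)) (2 * π) := fun t => hp (t, p)
  obtain ⟨s, hs, hst⟩ := hper.exists_mem_Ico₀ (by positivity) t
  have := hmin (show (s, p) ∈ _ from ⟨⟨hs.1, hs.2.le⟩, hq⟩)
  simp only [mem_setOf_eq] at this
  exact this.trans hst.symm.le

lemma EE_cont (f : Pt → ℝ) (hf : ContDiff ℝ (⊤ : ℕ∞) f) : Continuous (EE f) := by
  have h1 := hf.continuous
  have h2 : Continuous (fderiv ℝ f) := hf.continuous_fderiv (by simp)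
  unfold EE
  exact (continuous_const.mul h1).add (h2.clm_apply (by fun_prop))

lemma EE_per (f : Pt → ℝ) (hp : IsPeriodic (2 * π) f) : IsPeriodic (2 * π) (EE f) := by
  intro q
  have h1 : (fun p : Pt => f (p + (2 * π, 0))) = f := by
    funext p
    have := hp p
    rw [← this]
    congr 1
    ext <;> simp
  have h2 := fderiv_comp_add_right (𝕜 := ℝ) (f := f) (x := q) ((2 * π, 0) : Pt)
  rw [h1] at h2
  have h3 : q + ((2 * π, 0) : Pt) = (q.1 + 2 * π, q.2) := by ext <;> simp
  rw [h3] at h2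
  simp only [EE]
  rw [← h2, hp q]

lemma st_bound : ∃ C > 0, ∀ t, |deriv Real.smoothTransition t| ≤ C := by
  have hc : Continuous (deriv Real.smoothTransition) :=
    (Real.smoothTransition.contDiff (n := 1)).continuous_deriv le_rfl
  obtain ⟨C, hC⟩ := (isCompact_Icc (a := (0:ℝ)) (b := 1)).exists_bound_of_continuousOn
    hc.continuousOn
  refine ⟨|C| + 1, by positivity, fun t => ?_⟩
  have hz : ∀ c : ℝ, Real.smoothTransition =ᶠ[nhds t] (fun _ => c) →
      |deriv Real.smoothTransition t| ≤ |C| + 1 := by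
    intro c h
    rw [h.deriv_eq]
    simp
    positivity
  rcases lt_or_ge t 0 with h | h
  · apply hz 0
    filter_upwards [Iio_mem_nhds h] with s hs
    exact Real.smoothTransition.zero_of_nonpos (le_of_lt hs)
  rcases lt_or_ge 1 t with h' | h'
  · apply hz 1
    filter_upwards [Ioi_mem_nhds h'] with s hs
    exact Real.smoothTransition.one_of_one_le (le_of_lt hs)
  have := hC t ⟨h, h'⟩
  rw [Real.norm_eq_abs] at this
  linarith [le_abs_self C]

noncomputable def chi (L N ε : ℝ) (q : Pt) : ℝ :=
  Real.smoothTransition ((L - Real.log (q.2.1 ^ 2 + q.2.2 ^ 2 + ε)) / N)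

lemma chi_smooth (L N ε : ℝ) (hε : 0 < ε) : ContDiff ℝ (⊤ : ℕ∞) (chi L N ε) := by
  unfold chi
  apply Real.smoothTransition.contDiff.comp
  apply ContDiff.div_const
  apply contDiff_const.sub
  apply ContDiff.log
  · fun_prop
  · intro q
    positivity

lemma chi_deriv (L N ε C : ℝ) (hN : 0 < N) (hε : 0 < ε)
    (hC : ∀ t, |deriv Real.smoothTransition t| ≤ C) (q : Pt) :
    |fderiv ℝ (chi L N ε) q (0, q.2.1, q.2.2)| ≤ 2 * C / N := by
  set ρ := q.2.1 ^ 2 + q.2.2 ^ 2 with hρ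
  have hρ0 : 0 ≤ ρ := by positivity
  have hd : HasFDerivAt (chi L N ε) (fderiv ℝ (chi L N ε) q) (q + (0:ℝ) • ((0, q.2.1, q.2.2) : Pt)) := by
    rw [zero_smul, add_zero]
    exact ((chi_smooth L N ε hε).differentiable (by simp) q).hasFDerivAt
  have hl : HasDerivAt (fun t : ℝ => q + t • ((0, q.2.1, q.2.2) : Pt)) ((0, q.2.1, q.2.2) : Pt) 0 := by
    simpa using ((hasDerivAt_id (0:ℝ)).smul_const ((0, q.2.1, q.2.2) : Pt)).const_add q
  have h1 := hd.comp_hasDerivAt (0:ℝ) hl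
  have h2 : HasDerivAt (fun t : ℝ => (1 + t) ^ 2 * ρ + ε) (2 * ρ) 0 := by
    have := ((((hasDerivAt_id (0:ℝ)).const_add 1).pow 2).mul_const ρ).add_const ε
    simpa using this
  have h3 := h2.log (by simp; positivity)
  have h4 := (h3.const_sub L).div_const N
  have h5 : HasDerivAt Real.smoothTransition
      (deriv Real.smoothTransition ((L - Real.log ((1 + (0:ℝ)) ^ 2 * ρ + ε)) / N))
      ((L - Real.log ((1 + (0:ℝ)) ^ 2 * ρ + ε)) / N) :=
    ((Real.smoothTransition.contDiff (n := 1)).differentiable (by simp) _).hasDerivAt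
  have h6 := h5.comp (0:ℝ) h4
  have h7 : (chi L N ε ∘ fun t : ℝ => q + t • ((0, q.2.1, q.2.2) : Pt)) =
      (Real.smoothTransition ∘ fun t : ℝ => (L - Real.log ((1 + t) ^ 2 * ρ + ε)) / N) := by
    funext t
    simp only [chi, Function.comp, hρ]
    congr 4
    simp
    ring
  rw [h7] at h1
  rw [h1.unique h6, abs_mul]
  have h8 : |-(2 * ρ / ((1 + (0:ℝ)) ^ 2 * ρ + ε)) / N| ≤ 2 / N := by
    rw [abs_div, abs_neg, abs_of_pos hN, abs_of_nonneg (by positivity)]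
    gcongr
    rw [div_le_iff₀ (by positivity)]
    nlinarith
  calc _ ≤ C * (2 / N) := mul_le_mul (hC _) h8 (abs_nonneg _) ((abs_nonneg _).trans (hC 0))
    _ = _ := by ring

lemma EE_interp (f₀ f₁ χ : Pt → ℝ) (h0 : Differentiable ℝ f₀) (h1 : Differentiable ℝ f₁)
    (hχ : Differentiable ℝ χ) (q : Pt) :
    EE (fun p => f₀ p + χ p * (f₁ p - f₀ p)) q =
      (1 - χ q) * EE f₀ q + χ q * EE f₁ q +
        fderiv ℝ χ q (0, q.2.1, q.2.2) * (f₁ q - f₀ q) := by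
  have := (h0 q).hasFDerivAt.add ((hχ q).hasFDerivAt.mul ((h1 q).hasFDerivAt.sub (h0 q).hasFDerivAt))
  have h : fderiv ℝ (fun p => f₀ p + χ p * (f₁ p - f₀ p)) q = _ := this.fderiv
  simp only [EE, h]
  simp
  ring

/-- **Interpolation of contact forms defining `ξ_st` adapted to the `θ`-fibration.**
On the solid torus `V = S¹ × D²_δ` (angle `θ` of period `2π`), let
`α₀ = f₀·(dθ + r²dφ)` and `α₁ = f₁·(dθ + r²dφ)` be two positive contact forms
defining the standard contact structure `ξ_st` (`f₀, f₁ > 0`) with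
`dθ∧dα₀ > 0` and `dθ∧dα₁ > 0` on `V`. Then there is a positive contact form
`α = f·(dθ + r²dφ)` defining `ξ_st` with `dθ∧dα > 0`, which coincides with `α₀`
near `∂V` and with `α₁` near the core circle. -/
theorem stmt_2 (δ : ℝ) (hδ : 0 < δ)
    (f₀ f₁ : Pt → ℝ)
    (hsm₀ : ContDiff ℝ (⊤ : ℕ∞) f₀) (hsm₁ : ContDiff ℝ (⊤ : ℕ∞) f₁)
    (hper₀ : IsPeriodic (2 * π) f₀) (hper₁ : IsPeriodic (2 * π) f₁)
    (hpos₀ : ∀ q ∈ Vset δ, 0 < f₀ q) (hpos₁ : ∀ q ∈ Vset δ, 0 < f₁ q)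
    (hcon₀ : ∀ q ∈ Vset δ,
      0 < wedgeD (fun x => f₀ x • alphaSt x) (fun x => f₀ x • alphaSt x) q)
    (hcon₁ : ∀ q ∈ Vset δ,
      0 < wedgeD (fun x => f₁ x • alphaSt x) (fun x => f₁ x • alphaSt x) q)
    (hθ₀ : ∀ q ∈ Vset δ, 0 < wedgeD (fun _ => (1, 0, 0)) (fun x => f₀ x • alphaSt x) q)
    (hθ₁ : ∀ q ∈ Vset δ, 0 < wedgeD (fun _ => (1, 0, 0)) (fun x => f₁ x • alphaSt x) q) :
    ∃ f : Pt → ℝ, ContDiff ℝ (⊤ : ℕ∞) f ∧ IsPeriodic (2 * π) f ∧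
      (∀ q ∈ Vset δ, 0 < f q) ∧
      (∀ q ∈ Vset δ,
        0 < wedgeD (fun x => f x • alphaSt x) (fun x => f x • alphaSt x) q) ∧
      (∀ q ∈ Vset δ, 0 < wedgeD (fun _ => (1, 0, 0)) (fun x => f x • alphaSt x) q) ∧
      (∃ δ₁ ∈ Ioo 0 δ, ∀ q ∈ Vset δ, δ₁ ≤ rad q → f q = f₀ q) ∧
      (∃ η > 0, ∀ q ∈ Vset δ, rad q ≤ η → f q = f₁ q) := by
  have d0 : Differentiable ℝ f₀ := hsm₀.differentiable (by simp)
  have d1 : Differentiable ℝ f₁ := hsm₁.differentiable (by simp)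
  obtain ⟨a0, ha0, hm0⟩ := exists_min δ _ (EE_cont f₀ hsm₀) (EE_per f₀ hper₀)
  obtain ⟨a1, ha1, hm1⟩ := exists_min δ _ (EE_cont f₁ hsm₁) (EE_per f₁ hper₁)
  have p0 : 0 < EE f₀ a0 := by rw [← wedge_one f₀ d0]; exact hθ₀ _ ha0
  have p1 : 0 < EE f₁ a1 := by rw [← wedge_one f₁ d1]; exact hθ₁ _ ha1
  obtain ⟨b, hb, hM⟩ := exists_min δ (fun q => -|f₁ q - f₀ q|)
    (by have := hsm₀.continuous; have := hsm₁.continuous; fun_prop)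
    (fun q => by simp only [hper₀ q, hper₁ q])
  obtain ⟨C, hC0, hC⟩ := st_bound
  set M := |f₁ b - f₀ b| with hMdef
  have hM0 : 0 ≤ M := abs_nonneg _
  set m := min (EE f₀ a0) (EE f₁ a1) with hmdef
  have hm : 0 < m := lt_min p0 p1
  set N := 2 * C * (M + 1) / m with hN
  have hN0 : 0 < N := by positivity
  set L := Real.log (δ ^ 2 / 4) with hL
  set ε := δ ^ 2 / 8 * Real.exp (-N) with hε
  have hε0 : 0 < ε := by positivity
  have dχ : Differentiable ℝ (chi L N ε) := (chi_smooth L N ε hε0).differentiable (by simp)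
  have c0 : ∀ q, 0 ≤ chi L N ε q := fun q => Real.smoothTransition.nonneg _
  have c1 : ∀ q, chi L N ε q ≤ 1 := fun q => Real.smoothTransition.le_one _
  have hsm : ContDiff ℝ (⊤ : ℕ∞) (fun p => f₀ p + chi L N ε p * (f₁ p - f₀ p)) :=
    hsm₀.add ((chi_smooth L N ε hε0).mul (hsm₁.sub hsm₀))
  have hd := hsm.differentiable (by simp)
  have hpos : ∀ q ∈ Vset δ, 0 < f₀ q + chi L N ε q * (f₁ q - f₀ q) := by
    intro q hq
    have := hpos₀ q hq
    have := hpos₁ q hq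
    rcases (c0 q).eq_or_lt with h | h
    · rw [← h]; linarith
    · nlinarith [mul_pos h (hpos₁ q hq), mul_nonneg (sub_nonneg.2 (c1 q)) (hpos₀ q hq).le]
  refine ⟨_, hsm, ?_, hpos, ?_, ?_, ⟨δ / 2, ⟨by linarith, by linarith⟩, ?_⟩,
    ⟨Real.sqrt ε, by positivity, ?_⟩⟩
  · intro q
    simp only [hper₀ q, hper₁ q]
    rfl
  · intro q hq
    rw [wedge_self _ hd]
    have := hpos q hq
    positivity
  · intro q hq
    rw [wedge_one _ hd, EE_interp _ _ _ d0 d1 dχ]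
    have e0 : m ≤ EE f₀ q := (min_le_left _ _).trans (hm0 q hq)
    have e1 : m ≤ EE f₁ q := (min_le_right _ _).trans (hm1 q hq)
    have e2 : |f₁ q - f₀ q| ≤ M := by
      have := hM q hq
      linarith
    have e3 := chi_deriv L N ε C hN0 hε0 hC q
    have e4 : 2 * C / N * M < m := by
      have : 2 * C / N = m / (M + 1) := by
        rw [hN]; field_simp
      rw [this, div_mul_eq_mul_div, div_lt_iff₀ (by positivity)]
      nlinarith
    have e5 : |fderiv ℝ (chi L N ε) q (0, q.2.1, q.2.2) * (f₁ q - f₀ q)| ≤ 2 * C / N * M := by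
      rw [abs_mul]
      exact mul_le_mul e3 e2 (abs_nonneg _) (by positivity)
    have e6 := (abs_le.1 e5).1
    nlinarith [mul_nonneg (c0 q) (sub_nonneg.2 e1),
      mul_nonneg (sub_nonneg.2 (c1 q)) (sub_nonneg.2 e0)]
  · intro q _ hr
    have h1 : δ ^ 2 / 4 ≤ q.2.1 ^ 2 + q.2.2 ^ 2 := by
      have := (Real.le_sqrt' (by positivity)).1 hr
      nlinarith
    have : chi L N ε q = 0 := by
      apply Real.smoothTransition.zero_of_nonpos
      apply div_nonpos_of_nonpos_of_nonneg _ hN0.le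
      rw [sub_nonpos]
      apply Real.log_le_log (by positivity)
      linarith
    simp [this]
  · intro q _ hr
    have h1 : q.2.1 ^ 2 + q.2.2 ^ 2 ≤ ε := (Real.sqrt_le_sqrt_iff hε0.le).1 hr
    have : chi L N ε q = 1 := by
      apply Real.smoothTransition.one_of_one_le
      rw [le_div_iff₀ hN0, one_mul]
      have h2 : Real.log (q.2.1 ^ 2 + q.2.2 ^ 2 + ε) ≤ Real.log (δ ^ 2 / 4 * Real.exp (-N)) := by
        apply Real.log_le_log (by positivity)
        linarith
      rw [Real.log_mul (by positivity) (by positivity), Real.log_exp] at h2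
      linarith
    simp [this]
end
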